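/- In the perturbed Gaussian Bayesian setting (standard normal ρ_X on ℝ^n, nonnegative continuously differentiable data misfit f with ρ_X-square-integrable gradient, eigenvalues λ₁ ≥ ⋯ ≥ λ_n ≥ 0 of C = ∫ ∇f ∇fᵀ ρ_X dx with eigenvector matrix W, orthogonal Ŵ with ‖W − Ŵ‖ ≤ ε, true posterior ρ_post(x) = e^{−f(x)} ρ_X(x)/Z with Z = ∫ e^{−f} ρ_X dx, and random approximate posterior ρ_{post,ĝ_N}(x,ω) = e^{−f_{ĝ_N}(x,ω)} ρ_X(x)/Z_{ĝ_N}(ω) built from the N-sample Monte Carlo ridge approximation f_{ĝ_N}), it holds that E[ d_H(ρ_post, ρ_{post,ĝ_N}(·)) ] ≤ L (1 + N^{−1/2}) ( ε(λ₁ + ⋯ + λ_k)^{1/2} + (λ_{k+1} + ⋯ + λ_n)^{1/2} ), where L² = (1/8) ( Z · exp(−∫ f ρ_X dx) )^{−1/2}. -/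

import Mathlib

open MeasureTheory Matrix Set ProbabilityTheory
open scoped Matrix.Norms.L2Operator

/-- The standard normal density on `ℝ^n`. -/
noncomputable def gaussDensity (n : ℕ) (x : Fin n → ℝ) : ℝ :=
  (2 * Real.pi) ^ (-(n : ℝ) / 2) * Real.exp (-(∑ i, x i ^ 2) / 2)

/-- The vector of partial derivatives (gradient) of `f : ℝ^n → ℝ`. -/
noncomputable def pgrad {n : ℕ} (f : (Fin n → ℝ) → ℝ) (x : Fin n → ℝ) : Fin n → ℝ :=
  fun i => fderiv ℝ f x (Pi.single i 1)

/-- The Hellinger distance between two densities on `ℝ^n`: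
`d_H(p,q) = ((1/2) ∫ (√p - √q)² dx)^{1/2}`. -/
noncomputable def hellingerDist {n : ℕ} (p q : (Fin n → ℝ) → ℝ) : ℝ :=
  Real.sqrt ((1 / 2) * ∫ x, (Real.sqrt (p x) - Real.sqrt (q x)) ^ 2)


/-- Standard Gaussian measure as a product measure. -/
noncomputable def gaussM (n : ℕ) : Measure (Fin n → ℝ) :=
  Measure.pi (fun _ : Fin n => gaussianReal 0 1)

instance gaussM_prob (n : ℕ) : IsProbabilityMeasure (gaussM n) := by
  unfold gaussM; infer_instance

lemma gaussDensity_eq_prod (n : ℕ) (x : Fin n → ℝ) :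
    gaussDensity n x = ∏ i, gaussianPDFReal 0 1 (x i) := by
  unfold gaussDensity gaussianPDFReal
  rw [Finset.prod_mul_distrib, ← Real.exp_sum]
  congr 1
  · simp only [NNReal.coe_one, mul_one, Finset.prod_const, Finset.card_univ, Fintype.card_fin]
    have h : (0:ℝ) ≤ 2 * Real.pi := by positivity
    rw [inv_pow, Real.sqrt_eq_rpow, ← Real.rpow_natCast, ← Real.rpow_mul h, ← Real.rpow_neg h]
    congr 1; ring
  · congr 1
    rw [neg_div, Finset.sum_div, ← Finset.sum_neg_distrib]
    refine Finset.sum_congr rfl fun i _ => ?_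
    simp; ring

lemma gaussDensity_pos (n : ℕ) (x : Fin n → ℝ) : 0 < gaussDensity n x := by
  unfold gaussDensity; positivity

lemma gaussDensity_cont (n : ℕ) : Continuous (gaussDensity n) := by
  unfold gaussDensity; fun_prop

lemma withDensity_gauss (n : ℕ) :
    (volume.withDensity fun z : Fin n → ℝ => ENNReal.ofReal (gaussDensity n z)) = gaussM n := by
  symm
  refine Measure.pi_eq fun s hs => ?_
  rw [withDensity_apply _ (MeasurableSet.univ_pi hs), volume_pi, Measure.restrict_pi_pi]
  simp_rw [gaussianReal_apply_eq_integral 0 one_ne_zero]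
  rw [← ENNReal.ofReal_prod_of_nonneg
    (fun i _ => setIntegral_nonneg (hs i) fun x _ => gaussianPDFReal_nonneg _ _ _)]
  rw [← integral_fintype_prod_eq_prod (fun i => gaussianPDFReal 0 1)]
  rw [ofReal_integral_eq_lintegral_ofReal]
  · simp_rw [gaussDensity_eq_prod]
  · exact Integrable.fintype_prod (f := fun i => gaussianPDFReal 0 1)
      (fun i => (integrable_gaussianPDFReal 0 1).restrict)
  · exact Filter.Eventually.of_forall fun x =>
      Finset.prod_nonneg fun i _ => gaussianPDFReal_nonneg _ _ _

lemma integral_gauss (n : ℕ) (g : (Fin n → ℝ) → ℝ) :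
    ∫ x, g x * gaussDensity n x = ∫ x, g x ∂(gaussM n) := by
  rw [← withDensity_gauss, integral_withDensity_eq_integral_toReal_smul
    (gaussDensity_cont n).measurable.ennreal_ofReal (by simp)]
  refine integral_congr_ae (Filter.Eventually.of_forall fun x => ?_)
  simp [ENNReal.toReal_ofReal (gaussDensity_pos n x).le, mul_comm]

lemma integrable_gauss (n : ℕ) (g : (Fin n → ℝ) → ℝ) :
    Integrable (fun x => g x * gaussDensity n x) ↔ Integrable g (gaussM n) := by
  rw [← withDensity_gauss, integrable_withDensity_iff_integrable_smul'
    (gaussDensity_cont n).measurable.ennreal_ofReal (by simp)]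
  refine integrable_congr (Filter.Eventually.of_forall fun x => ?_)
  simp [ENNReal.toReal_ofReal (gaussDensity_pos n x).le, mul_comm]

lemma mulVec_pres (n : ℕ) (U : Matrix (Fin n) (Fin n) ℝ) (hU : Uᵀ * U = 1) :
    MeasurePreserving (fun x => U *ᵥ x) (gaussM n) (gaussM n) := by
  have hdet : U.det ^ 2 = 1 := by
    have := congrArg Matrix.det hU
    rw [Matrix.det_mul, Matrix.det_transpose, Matrix.det_one] at this
    rw [sq]; exact this
  have hne : U.det ≠ 0 := by intro h; rw [h] at hdet; norm_num at hdet
  have hab : |U.det| = 1 := by rw [← sq_eq_sq₀ (abs_nonneg _) zero_le_one, sq_abs, hdet]; norm_num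
  have hm : Measurable (fun x => U *ᵥ x) := (by fun_prop : Continuous (fun x => U *ᵥ x)).measurable
  have hv : MeasurePreserving (fun x => U *ᵥ x) (volume : Measure (Fin n → ℝ)) volume := by
    refine ⟨hm, ?_⟩
    have := Real.map_matrix_volume_pi_eq_smul_volume_pi hne
    rw [abs_inv, hab] at this
    rw [inv_one, ENNReal.ofReal_one, one_smul] at this
    exact this
  have hg : ∀ x, gaussDensity n (U *ᵥ x) = gaussDensity n x := by
    intro x
    unfold gaussDensity
    have : ∑ i, (U *ᵥ x) i ^ 2 = ∑ i, x i ^ 2 := by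
      have h1 : (U *ᵥ x) ⬝ᵥ (U *ᵥ x) = x ⬝ᵥ x := by
        rw [Matrix.dotProduct_mulVec, ← Matrix.mulVec_transpose, Matrix.mulVec_mulVec, hU,
          Matrix.one_mulVec]
      simpa [dotProduct, sq] using h1
    rw [this]
  refine ⟨hm, ?_⟩
  rw [← withDensity_gauss]
  ext s hs
  rw [Measure.map_apply hm hs, withDensity_apply _ (hm hs), withDensity_apply _ hs]
  rw [← hv.setLIntegral_comp_preimage hs (gaussDensity_cont n).measurable.ennreal_ofReal]
  simp_rw [hg]

lemma append_pres (k m : ℕ) :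
    MeasurePreserving (fun p : (Fin k → ℝ) × (Fin m → ℝ) => Fin.append p.1 p.2)
      ((gaussM k).prod (gaussM m)) (gaussM (k + m)) := by
  have h1 := measurePreserving_sumPiEquivProdPi_symm (X := fun _ : Fin k ⊕ Fin m => ℝ)
    (fun _ => gaussianReal 0 1)
  have h2 := measurePreserving_piCongrLeft (fun _ : Fin (k + m) => gaussianReal 0 1)
    (finSumFinEquiv (m := k) (n := m))
  have h := h2.comp h1
  unfold gaussM
  convert h using 1
  funext p
  funext i
  refine Fin.addCases (fun i => ?_) (fun i => ?_) i
  · rw [Fin.append_left]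
    have := MeasurableEquiv.piCongrLeft_apply_apply (β := fun _ : Fin (k + m) => ℝ)
      (finSumFinEquiv (m := k) (n := m))
      ((MeasurableEquiv.sumPiEquivProdPi fun x => ℝ).symm p) (Sum.inl i)
    simp only [finSumFinEquiv_apply_left] at this
    exact this.symm
  · rw [Fin.append_right]
    have := MeasurableEquiv.piCongrLeft_apply_apply (β := fun _ : Fin (k + m) => ℝ)
      (finSumFinEquiv (m := k) (n := m))
      ((MeasurableEquiv.sumPiEquivProdPi fun x => ℝ).symm p) (Sum.inr i)
    simp only [finSumFinEquiv_apply_right] at this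
    exact this.symm

lemma split_mulVec (k m : ℕ) (U : Matrix (Fin (k + m)) (Fin (k + m)) ℝ)
    (y : Fin k → ℝ) (z : Fin m → ℝ) :
    U *ᵥ Fin.append y z = U.submatrix id (Fin.castAdd m) *ᵥ y +
      U.submatrix id (Fin.natAdd k) *ᵥ z := by
  funext i
  simp [Matrix.mulVec, dotProduct, Fin.sum_univ_add]

lemma T_pres (k m : ℕ) (U : Matrix (Fin (k + m)) (Fin (k + m)) ℝ) (hU : Uᵀ * U = 1) :
    MeasurePreserving (fun p : (Fin k → ℝ) × (Fin m → ℝ) =>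
      U.submatrix id (Fin.castAdd m) *ᵥ p.1 + U.submatrix id (Fin.natAdd k) *ᵥ p.2)
      ((gaussM k).prod (gaussM m)) (gaussM (k + m)) := by
  have := (mulVec_pres _ U hU).comp (append_pres k m)
  convert this using 1
  funext p
  exact (split_mulVec k m U p.1 p.2).symm

lemma T_inv (k m : ℕ) (U : Matrix (Fin (k + m)) (Fin (k + m)) ℝ) (hU : Uᵀ * U = 1)
    (y : Fin k → ℝ) (z : Fin m → ℝ) :
    (U.submatrix id (Fin.castAdd m))ᵀ *ᵥ (U.submatrix id (Fin.castAdd m) *ᵥ y +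
      U.submatrix id (Fin.natAdd k) *ᵥ z) = y := by
  rw [← split_mulVec]
  have h : Uᵀ *ᵥ (U *ᵥ Fin.append y z) = Fin.append y z := by
    rw [Matrix.mulVec_mulVec, hU, Matrix.one_mulVec]
  funext i
  have := congrFun h (Fin.castAdd m i)
  rw [Fin.append_left] at this
  exact this

lemma gauss_Ici_id (s : ℝ) : ∫ x in Set.Ici s, x ∂(gaussianReal 0 1) = gaussianPDFReal 0 1 s := by
  have hd : ∀ x : ℝ, HasDerivAt (fun x => -gaussianPDFReal 0 1 x)
      (gaussianPDFReal 0 1 x * x) x := by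
    intro x
    unfold gaussianPDFReal
    have h1 : HasDerivAt (fun x : ℝ => -(x - 0) ^ 2 / (2 * ((1 : NNReal) : ℝ))) (-x) x := by
      have := (((hasDerivAt_id x).sub_const 0).pow 2).neg.div_const (2 * ((1 : NNReal) : ℝ))
      refine this.congr_deriv ?_
      simp; ring
    have h2 := (h1.exp.const_mul (√(2 * Real.pi * ((1 : NNReal) : ℝ)))⁻¹).neg
    refine h2.congr_deriv ?_
    ring
  have hPint : Integrable (fun x => gaussianPDFReal 0 1 x * x) := by
    have := (memLp_id_gaussianReal (μ := 0) (v := 1) 1).integrable (by simp)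
    rw [gaussianReal_of_var_ne_zero 0 one_ne_zero, integrable_withDensity_iff_integrable_smul'
      (measurable_gaussianPDF 0 1) (by simp [gaussianPDF])] at this
    refine this.congr (Filter.Eventually.of_forall fun x => ?_)
    simp [toReal_gaussianPDF]
  have htend : Filter.Tendsto (fun x => -gaussianPDFReal 0 1 x) Filter.atTop (nhds 0) := by
    have h2 : Filter.Tendsto (fun x : ℝ => Real.exp (-(x - 0) ^ 2 / (2 * ((1 : NNReal) : ℝ))))
        Filter.atTop (nhds 0) := by
      refine Real.tendsto_exp_atBot.comp ?_
      have : (fun x : ℝ => -(x - 0) ^ 2 / (2 * ((1 : NNReal) : ℝ))) = fun x => -(x ^ 2 / 2) := by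
        funext x; simp; ring
      rw [this]
      refine Filter.tendsto_neg_atTop_atBot.comp ?_
      exact (Filter.tendsto_pow_atTop two_ne_zero).atTop_div_const (by norm_num)
    have := (h2.const_mul (√(2 * Real.pi * ((1 : NNReal) : ℝ)))⁻¹).neg
    unfold gaussianPDFReal
    simpa using this
  have key := integral_Ioi_of_hasDerivAt_of_tendsto' (a := s) (fun x _ => hd x)
    hPint.integrableOn htend
  rw [gaussianReal_of_var_ne_zero 0 one_ne_zero,
    setIntegral_withDensity_eq_setIntegral_toReal_smul (measurable_gaussianPDF 0 1)
      (by simp [gaussianPDF]) _ measurableSet_Ici, integral_Ici_eq_integral_Ioi]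
  simp only [toReal_gaussianPDF, smul_eq_mul]
  rw [key]; simp

lemma gauss_int_id : Integrable (fun x : ℝ => x) (gaussianReal 0 1) :=
  (memLp_id_gaussianReal (μ := 0) (v := 1) 1).integrable (by simp)

lemma gauss_Iio_id (s : ℝ) :
    ∫ x in Set.Iio s, x ∂(gaussianReal 0 1) = -gaussianPDFReal 0 1 s := by
  have h := integral_add_compl (measurableSet_Ici (a := s)) gauss_int_id
  rw [gauss_Ici_id, Set.compl_Ici, integral_id_gaussianReal] at h
  linarith

lemma kernel_int (s : ℝ) :
    ∫⁻ x in Set.Ici s, ∫⁻ y in Set.Iio s, ENNReal.ofReal (x - y) ∂(gaussianReal 0 1)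
      ∂(gaussianReal 0 1) = gaussianPDF 0 1 s := by
  set γ := gaussianReal 0 1 with hγ
  have h1 : ∀ x ∈ Set.Ici s, ∫⁻ y in Set.Iio s, ENNReal.ofReal (x - y) ∂γ =
      ENNReal.ofReal (x * γ.real (Set.Iio s) + gaussianPDFReal 0 1 s) := by
    intro x hx
    rw [← ofReal_integral_eq_lintegral_ofReal]
    · congr 1
      rw [integral_sub (integrable_const _) gauss_int_id.restrict, gauss_Iio_id]
      simp [mul_comm, hγ]
    · exact (integrable_const _).sub gauss_int_id.restrict
    · filter_upwards [ae_restrict_mem measurableSet_Iio] with y hy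
      simp only [Set.mem_Ici, Set.mem_Iio] at hx hy
      simp; linarith
  rw [setLIntegral_congr_fun measurableSet_Ici h1, ← ofReal_integral_eq_lintegral_ofReal]
  · rw [gaussianPDF]
    congr 1
    rw [integral_add (gauss_int_id.restrict.mul_const _) (integrable_const _),
      integral_mul_const, gauss_Ici_id]
    have h2 : γ.real (Set.Iio s) + γ.real (Set.Ici s) = 1 := by
      have := probReal_add_probReal_compl (μ := γ) (measurableSet_Iio (a := s))
      rwa [Set.compl_Iio] at this
    simp
    linear_combination (gaussianPDFReal 0 1 s) * h2
  · exact (gauss_int_id.restrict.mul_const _).add (integrable_const _)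
  · filter_upwards [ae_restrict_mem measurableSet_Ici] with x hx
    have h3 : 0 ≤ ∫ y in Set.Iio s, (x - y) ∂γ := by
      refine setIntegral_nonneg measurableSet_Iio fun y hy => ?_
      simp only [Set.mem_Ici, Set.mem_Iio] at hx hy
      linarith
    rw [integral_sub (integrable_const _) gauss_int_id.restrict, gauss_Iio_id] at h3
    simp at h3
    simp; linarith

lemma sq_diff_le (f f' : ℝ → ℝ) (hf : ∀ x, HasDerivAt f (f' x) x) (hc : Continuous f')
    {x y : ℝ} (hxy : y ≤ x) :
    ENNReal.ofReal ((f x - f y) ^ 2) ≤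
      ENNReal.ofReal (x - y) * ∫⁻ s in Set.Ioc y x, ENNReal.ofReal (f' s ^ 2) := by
  have hI : ∫ s in y..x, f' s = f x - f y :=
    intervalIntegral.integral_eq_sub_of_hasDerivAt (fun s _ => hf s) (hc.intervalIntegrable _ _)
  have hsqi : IntervalIntegrable (fun s => f' s ^ 2) volume y x :=
    (hc.pow 2).intervalIntegrable _ _
  rw [← ofReal_integral_eq_lintegral_ofReal hsqi.1
    (Filter.Eventually.of_forall fun s => sq_nonneg _),
    ← intervalIntegral.integral_of_le hxy, ← ENNReal.ofReal_mul (by linarith)]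
  refine ENNReal.ofReal_le_ofReal ?_
  set c := f x - f y with hcdef
  set Q := ∫ s in y..x, f' s ^ 2 with hQ
  rcases hxy.eq_or_lt with h | h
  · subst h; simp [hcdef]
  have hpos : 0 ≤ ∫ s in y..x, (f' s * (x - y) - c) ^ 2 :=
    intervalIntegral.integral_nonneg hxy fun s _ => sq_nonneg _
  have hexp : ∫ s in y..x, (f' s * (x - y) - c) ^ 2 =
      (x - y) ^ 2 * Q - 2 * (x - y) * c * c + c ^ 2 * (x - y) := by
    have e : (fun s => (f' s * (x - y) - c) ^ 2) = fun s =>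
        ((x - y) ^ 2 * f' s ^ 2 - 2 * (x - y) * c * f' s) + c ^ 2 := by
      funext s; ring
    have hfi : IntervalIntegrable f' volume y x := hc.intervalIntegrable _ _
    rw [e, intervalIntegral.integral_add
      ((hsqi.const_mul _).sub (hfi.const_mul _)) (by simp),
      intervalIntegral.integral_sub (hsqi.const_mul _) (hfi.const_mul _),
      intervalIntegral.integral_const_mul, intervalIntegral.integral_const_mul, hI]
    simp; ring
  rw [hexp] at hpos
  have h0 : 0 < x - y := by linarith
  have : 0 ≤ (x - y) * ((x - y) * Q - c ^ 2) := by nlinarith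
  have := nonneg_of_mul_nonneg_right this h0
  linarith

/-- One dimensional Gaussian Poincaré inequality (in pair form). -/
lemma poincare_one (f f' : ℝ → ℝ) (hf : ∀ x, HasDerivAt f (f' x) x) (hc : Continuous f') :
    ∫⁻ x, ∫⁻ y, ENNReal.ofReal ((f x - f y) ^ 2) ∂(gaussianReal 0 1) ∂(gaussianReal 0 1) ≤
      2 * ∫⁻ s, ENNReal.ofReal (f' s ^ 2) ∂(gaussianReal 0 1) := by
  set γ := gaussianReal 0 1 with hγ
  let K : ℝ → ℝ → ℝ → ENNReal := fun x y s =>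
    (Set.Iio s).indicator 1 y * (Set.Ici s).indicator 1 x * ENNReal.ofReal (x - y)
  have hmI1 : MeasurableSet {q : (ℝ × ℝ) × ℝ | q.1.2 < q.2} :=
    measurableSet_lt (by fun_prop) (by fun_prop)
  have hmI2 : MeasurableSet {q : (ℝ × ℝ) × ℝ | q.2 ≤ q.1.1} :=
    measurableSet_le (by fun_prop) (by fun_prop)
  have hK : Measurable (fun q : (ℝ × ℝ) × ℝ => K q.1.1 q.1.2 q.2) := by
    have h1 : Measurable (fun q : (ℝ × ℝ) × ℝ => (Set.Iio q.2).indicator (1 : ℝ → ENNReal) q.1.2) :=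
      (measurable_one.indicator hmI1 : Measurable ({q : (ℝ × ℝ) × ℝ | q.1.2 < q.2}.indicator
        (1 : (ℝ × ℝ) × ℝ → ENNReal)))
    have h2 : Measurable (fun q : (ℝ × ℝ) × ℝ => (Set.Ici q.2).indicator (1 : ℝ → ENNReal) q.1.1) :=
      (measurable_one.indicator hmI2 : Measurable ({q : (ℝ × ℝ) × ℝ | q.2 ≤ q.1.1}.indicator
        (1 : (ℝ × ℝ) × ℝ → ENNReal)))
    exact (h1.mul h2).mul (by fun_prop)
  have hF : Measurable (fun s => ENNReal.ofReal (f' s ^ 2)) :=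
    (hc.pow 2).measurable.ennreal_ofReal
  have hKi : ∀ s, ∫⁻ x, ∫⁻ y, K x y s ∂γ ∂γ = gaussianPDF 0 1 s := by
    intro s
    rw [← kernel_int s, ← lintegral_indicator measurableSet_Ici]
    refine lintegral_congr fun x => ?_
    by_cases hx : x ∈ Set.Ici s
    · rw [Set.indicator_of_mem hx, ← lintegral_indicator measurableSet_Iio]
      refine lintegral_congr fun y => ?_
      by_cases hy : y ∈ Set.Iio s
      · simp [K, hx, hy, Set.indicator_of_mem]
      · simp [K, hy]
    · simp [K, hx]
  have hpair : ∀ x y, ENNReal.ofReal ((f x - f y) ^ 2) ≤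
      ∫⁻ s, (K x y s + K y x s) * ENNReal.ofReal (f' s ^ 2) := by
    have base : ∀ x y, y ≤ x → ENNReal.ofReal ((f x - f y) ^ 2) ≤
        ∫⁻ s, K x y s * ENNReal.ofReal (f' s ^ 2) := by
      intro x y hxy
      refine (sq_diff_le f f' hf hc hxy).trans ?_
      rw [← lintegral_const_mul _ hF, ← lintegral_indicator measurableSet_Ioc]
      refine lintegral_mono fun s => ?_
      by_cases hs : s ∈ Set.Ioc y x
      · have h1 : y < s := hs.1
        have h2 : s ≤ x := hs.2
        simp [K, hs, h1, h2, Set.indicator]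
      · simp [hs]
    intro x y
    rcases le_total y x with h | h
    · refine (base x y h).trans (lintegral_mono fun s => ?_)
      gcongr; exact le_self_add
    · have := base y x h
      rw [show (f y - f x) ^ 2 = (f x - f y) ^ 2 by ring] at this
      refine this.trans (lintegral_mono fun s => ?_)
      gcongr; exact le_add_self
  have hK2 : Measurable (fun q : (ℝ × ℝ) × ℝ => K q.1.2 q.1.1 q.2) :=
    hK.comp (by fun_prop : Measurable (fun q : (ℝ × ℝ) × ℝ => ((q.1.2, q.1.1), q.2)))
  calc ∫⁻ x, ∫⁻ y, ENNReal.ofReal ((f x - f y) ^ 2) ∂γ ∂γ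
      ≤ ∫⁻ x, ∫⁻ y, ∫⁻ s, (K x y s + K y x s) * ENNReal.ofReal (f' s ^ 2) ∂volume ∂γ ∂γ :=
        lintegral_mono fun x => lintegral_mono fun y => hpair x y
    _ = ∫⁻ q : ℝ × ℝ, ∫⁻ s, (K q.1 q.2 s + K q.2 q.1 s) * ENNReal.ofReal (f' s ^ 2) ∂volume
          ∂(γ.prod γ) := by
        rw [lintegral_prod]
        refine Measurable.aemeasurable ?_
        exact Measurable.lintegral_prod_right'
          (f := fun q : (ℝ × ℝ) × ℝ => (K q.1.1 q.1.2 q.2 + K q.1.2 q.1.1 q.2) *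
            ENNReal.ofReal (f' q.2 ^ 2)) ((hK.add hK2).mul (hF.comp measurable_snd))
    _ = ∫⁻ s, ∫⁻ q : ℝ × ℝ, (K q.1 q.2 s + K q.2 q.1 s) * ENNReal.ofReal (f' s ^ 2)
          ∂(γ.prod γ) :=
        lintegral_lintegral_swap ((hK.add hK2).mul (hF.comp measurable_snd)).aemeasurable
    _ = ∫⁻ s, gaussianPDF 0 1 s * (2 * ENNReal.ofReal (f' s ^ 2)) := by
        refine lintegral_congr fun s => ?_
        have m1 : Measurable (fun q : ℝ × ℝ => K q.1 q.2 s) :=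
          hK.comp (by fun_prop : Measurable (fun q : ℝ × ℝ => (q, s)))
        have m2 : Measurable (fun q : ℝ × ℝ => K q.2 q.1 s) :=
          hK2.comp (by fun_prop : Measurable (fun q : ℝ × ℝ => (q, s)))
        rw [lintegral_mul_const (ENNReal.ofReal (f' s ^ 2))
          (show Measurable (fun q : ℝ × ℝ => K q.1 q.2 s + K q.2 q.1 s) from m1.add m2), lintegral_add_left m1, lintegral_prod _ m1.aemeasurable,
          lintegral_prod_symm _ m2.aemeasurable]
        simp only [hKi]
        ring
    _ = 2 * ∫⁻ s, ENNReal.ofReal (f' s ^ 2) ∂γ := by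
        rw [hγ, gaussianReal_of_var_ne_zero 0 one_ne_zero,
          lintegral_withDensity_eq_lintegral_mul _ (measurable_gaussianPDF 0 1) hF,
          ← lintegral_const_mul _ ((measurable_gaussianPDF 0 1).mul hF)]
        refine lintegral_congr fun s => ?_
        simp only [Pi.mul_apply]; ring

lemma efron_two {α β : Type*} [MeasurableSpace α] [MeasurableSpace β] (μ : Measure α)
    (ν : Measure β) [IsProbabilityMeasure μ] [IsProbabilityMeasure ν] (F : α × β → ℝ)
    (hF : Measurable F) :
    ∫⁻ p, ∫⁻ q, ENNReal.ofReal ((F p - F q) ^ 2) ∂(μ.prod ν) ∂(μ.prod ν) ≤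
      (∫⁻ b, ∫⁻ a, ∫⁻ a', ENNReal.ofReal ((F (a, b) - F (a', b)) ^ 2) ∂μ ∂μ ∂ν) +
      ∫⁻ a, ∫⁻ b, ∫⁻ b', ENNReal.ofReal ((F (a, b) - F (a, b')) ^ 2) ∂ν ∂ν ∂μ := by
  set I := ∫⁻ a, ∫⁻ a', ∫⁻ b, ∫⁻ b', ENNReal.ofReal ((F (a, b) - F (a', b')) ^ 2) ∂ν ∂ν ∂μ ∂μ
    with hI
  set E1 := ∫⁻ b, ∫⁻ a, ∫⁻ a', ENNReal.ofReal ((F (a, b) - F (a', b)) ^ 2) ∂μ ∂μ ∂ν with hE1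
  set E2 := ∫⁻ a, ∫⁻ b, ∫⁻ b', ENNReal.ofReal ((F (a, b) - F (a, b')) ^ 2) ∂ν ∂ν ∂μ with hE2
  have hL : ∫⁻ p, ∫⁻ q, ENNReal.ofReal ((F p - F q) ^ 2) ∂(μ.prod ν) ∂(μ.prod ν) = I := by
    have m0 : Measurable (fun p : α × β => ∫⁻ q, ENNReal.ofReal ((F p - F q) ^ 2) ∂(μ.prod ν)) :=
      Measurable.lintegral_prod_right'
        (f := fun r : (α × β) × (α × β) => ENNReal.ofReal ((F r.1 - F r.2) ^ 2)) (by fun_prop)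
    rw [lintegral_prod _ m0.aemeasurable]
    refine lintegral_congr fun a => ?_
    have e : ∀ b, ∫⁻ q, ENNReal.ofReal ((F (a, b) - F q) ^ 2) ∂(μ.prod ν) =
        ∫⁻ a', ∫⁻ b', ENNReal.ofReal ((F (a, b) - F (a', b')) ^ 2) ∂ν ∂μ := fun b =>
      lintegral_prod _ (by fun_prop)
    simp_rw [e]
    refine lintegral_lintegral_swap (Measurable.aemeasurable ?_)
    exact Measurable.lintegral_prod_right'
        (f := fun r : (β × α) × β => ENNReal.ofReal ((F (a, r.1.1) - F (r.1.2, r.2)) ^ 2))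
        (by fun_prop)
  have hI' : I = ∫⁻ a, ∫⁻ a', ∫⁻ b, ∫⁻ b', ENNReal.ofReal ((F (a, b') - F (a', b)) ^ 2)
      ∂ν ∂ν ∂μ ∂μ := by
    refine lintegral_congr fun a => lintegral_congr fun a' => ?_
    exact lintegral_lintegral_swap (by fun_prop)
  have hT1 : ∫⁻ a, ∫⁻ a', ∫⁻ b, ENNReal.ofReal ((F (a, b) - F (a', b)) ^ 2) ∂ν ∂μ ∂μ = E1 := by
    have : ∀ a, ∫⁻ a', ∫⁻ b, ENNReal.ofReal ((F (a, b) - F (a', b)) ^ 2) ∂ν ∂μ =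
        ∫⁻ b, ∫⁻ a', ENNReal.ofReal ((F (a, b) - F (a', b)) ^ 2) ∂μ ∂ν := fun a =>
      lintegral_lintegral_swap (by fun_prop)
    simp_rw [this]
    refine lintegral_lintegral_swap (Measurable.aemeasurable ?_)
    exact Measurable.lintegral_prod_right'
        (f := fun r : (α × β) × α => ENNReal.ofReal ((F (r.1.1, r.1.2) - F (r.2, r.1.2)) ^ 2))
        (by fun_prop)
  have hT2 : ∫⁻ a, ∫⁻ b, ∫⁻ b', ENNReal.ofReal ((F (a, b') - F (a, b)) ^ 2) ∂ν ∂ν ∂μ = E2 := by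
    refine lintegral_congr fun a => ?_
    exact lintegral_lintegral_swap (by fun_prop)
  have hpt : ∀ x y z w : ℝ, ENNReal.ofReal ((x - z) ^ 2) + ENNReal.ofReal ((w - y) ^ 2) ≤
      (ENNReal.ofReal ((x - y) ^ 2) + ENNReal.ofReal ((w - z) ^ 2)) +
      (ENNReal.ofReal ((y - z) ^ 2) + ENNReal.ofReal ((w - x) ^ 2)) := by
    intro x y z w
    rw [← ENNReal.ofReal_add (by positivity) (by positivity),
      ← ENNReal.ofReal_add (by positivity) (by positivity),
      ← ENNReal.ofReal_add (by positivity) (by positivity),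
      ← ENNReal.ofReal_add (by positivity) (by positivity)]
    refine ENNReal.ofReal_le_ofReal ?_
    nlinarith [sq_nonneg (x - y + z - w)]
  let H : (α → α → β → β → ENNReal) → ENNReal := fun G => ∫⁻ a, ∫⁻ a', ∫⁻ b, ∫⁻ b', G a a' b b' ∂ν ∂ν ∂μ ∂μ
  have Hadd : ∀ G G' : α → α → β → β → ENNReal,
      Measurable (fun r : ((α × α) × β) × β => G r.1.1.1 r.1.1.2 r.1.2 r.2) →
      H (fun a a' b b' => G a a' b b' + G' a a' b b') = H G + H G' := by
    intro G G' hG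
    have m3 : Measurable (fun r : ((α × α) × β) => ∫⁻ b', G r.1.1 r.1.2 r.2 b' ∂ν) :=
      hG.lintegral_prod_right'
    have m2 : Measurable (fun r : (α × α) => ∫⁻ b, ∫⁻ b', G r.1 r.2 b b' ∂ν ∂ν) :=
      m3.lintegral_prod_right'
    have m1 : Measurable (fun r : α => ∫⁻ a', ∫⁻ b, ∫⁻ b', G r a' b b' ∂ν ∂ν ∂μ) :=
      m2.lintegral_prod_right'
    simp only [H]
    rw [← lintegral_add_left m1]
    refine lintegral_congr fun a => ?_
    have m2' : Measurable (fun a' : α => ∫⁻ b, ∫⁻ b', G a a' b b' ∂ν ∂ν) :=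
      m2.comp (by fun_prop : Measurable (fun a' : α => (a, a')))
    rw [← lintegral_add_left m2']
    refine lintegral_congr fun a' => ?_
    have m3' : Measurable (fun b : β => ∫⁻ b', G a a' b b' ∂ν) :=
      m3.comp (by fun_prop : Measurable (fun b : β => ((a, a'), b)))
    rw [← lintegral_add_left m3']
    refine lintegral_congr fun b => ?_
    have m4' : Measurable (fun b' : β => G a a' b b') :=
      hG.comp (by fun_prop : Measurable (fun b' : β => (((a, a'), b), b')))
    rw [← lintegral_add_left m4']
  have main : 2 * I ≤ 2 * (E1 + E2) := by
    calc 2 * I = H (fun a a' b b' => ENNReal.ofReal ((F (a, b) - F (a', b')) ^ 2)) +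
          H (fun a a' b b' => ENNReal.ofReal ((F (a, b') - F (a', b)) ^ 2)) := by
          rw [two_mul]; nth_rewrite 2 [hI']; rfl
      _ = H (fun a a' b b' => ENNReal.ofReal ((F (a, b) - F (a', b')) ^ 2) +
            ENNReal.ofReal ((F (a, b') - F (a', b)) ^ 2)) := (Hadd _ _ (by fun_prop)).symm
      _ ≤ H (fun a a' b b' => (ENNReal.ofReal ((F (a, b) - F (a', b)) ^ 2) +
            ENNReal.ofReal ((F (a, b') - F (a', b')) ^ 2)) +
            (ENNReal.ofReal ((F (a', b) - F (a', b')) ^ 2) +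
            ENNReal.ofReal ((F (a, b') - F (a, b)) ^ 2))) := by
          refine lintegral_mono fun a => lintegral_mono fun a' => lintegral_mono fun b =>
            lintegral_mono fun b' => hpt _ _ _ _
      _ = (H (fun a a' b b' => ENNReal.ofReal ((F (a, b) - F (a', b)) ^ 2)) +
            H (fun a a' b b' => ENNReal.ofReal ((F (a, b') - F (a', b')) ^ 2))) +
            (H (fun a a' b b' => ENNReal.ofReal ((F (a', b) - F (a', b')) ^ 2)) +
            H (fun a a' b b' => ENNReal.ofReal ((F (a, b') - F (a, b)) ^ 2))) := by
          rw [Hadd, Hadd, Hadd] <;> fun_prop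
      _ = (E1 + E1) + (E2 + E2) := by
          congr 1
          · congr 1
            · simpa [H] using hT1
            · simpa [H] using hT1
          · congr 1
            · simp [H, hE2]
            · simpa [H] using hT2
      _ = 2 * (E1 + E2) := by ring
  rw [hL]
  exact (ENNReal.mul_le_mul_iff_right (by norm_num) (by norm_num)).1 main

lemma cons_pres (m : ℕ) :
    MeasurePreserving (fun p : ℝ × (Fin m → ℝ) => (Fin.cons p.1 p.2 : Fin (m + 1) → ℝ))
      ((gaussianReal 0 1).prod (gaussM m)) (gaussM (m + 1)) := by
  have h := (measurePreserving_piFinSuccAbove (fun _ : Fin (m + 1) => gaussianReal 0 1) 0).symm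
  unfold gaussM
  convert h using 1
  funext p
  simp [MeasurableEquiv.piFinSuccAbove]
  rfl

lemma pgrad_cont {n : ℕ} {f : (Fin n → ℝ) → ℝ} (hf : ContDiff ℝ 1 f) (i : Fin n) :
    Continuous (fun x => pgrad f x i) :=
  (hf.continuous_fderiv (by norm_num)).clm_apply continuous_const

lemma cons_slice_one {m : ℕ} {f : (Fin (m + 1) → ℝ) → ℝ} (hf : ContDiff ℝ 1 f) (b : Fin m → ℝ)
    (a : ℝ) : HasDerivAt (fun a => f (Fin.cons a b)) (pgrad f (Fin.cons a b) 0) a := by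
  have h1 : HasDerivAt (fun a : ℝ => (Fin.cons a b : Fin (m + 1) → ℝ)) (Pi.single 0 1) a := by
    rw [hasDerivAt_pi]
    intro i
    refine Fin.cases ?_ (fun i => ?_) i
    · simpa using hasDerivAt_id' a
    · simpa using hasDerivAt_const a (b i)
  exact ((hf.differentiable (by norm_num)) _).hasFDerivAt.comp_hasDerivAt a h1

lemma cons_slice_rest {m : ℕ} {f : (Fin (m + 1) → ℝ) → ℝ} (hf : ContDiff ℝ 1 f) (a : ℝ) :
    ContDiff ℝ 1 (fun b : Fin m → ℝ => f (Fin.cons a b)) ∧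
    ∀ b i, pgrad (fun b : Fin m → ℝ => f (Fin.cons a b)) b i = pgrad f (Fin.cons a b) i.succ := by
  constructor
  · refine hf.comp (contDiff_pi.2 fun i => ?_)
    refine Fin.cases ?_ (fun i => ?_) i
    · simpa using contDiff_const
    · simpa using contDiff_apply ℝ ℝ i
  · intro b i
    let Lm : Fin (m + 1) → ((Fin m → ℝ) →L[ℝ] ℝ) :=
      Fin.cons 0 (fun i => ContinuousLinearMap.proj i)
    have h1 : HasFDerivAt (fun b : Fin m → ℝ => (Fin.cons a b : Fin (m + 1) → ℝ))
        (ContinuousLinearMap.pi Lm) b := by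
      rw [hasFDerivAt_pi]
      intro i
      refine Fin.cases ?_ (fun i => ?_) i
      · simpa [Lm] using hasFDerivAt_const a b
      · simpa [Lm] using hasFDerivAt_apply i b
    have h2 := ((hf.differentiable (by norm_num)) (Fin.cons a b)).hasFDerivAt.comp b h1
    have h3 := h2.fderiv
    unfold pgrad
    change (fderiv ℝ (f ∘ fun b : Fin m → ℝ => (Fin.cons a b : Fin (m + 1) → ℝ)) b) _ = _
    rw [h3, ContinuousLinearMap.comp_apply]
    congr 1
    funext j
    refine Fin.cases ?_ (fun j => ?_) j
    · simp [Lm]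
    · simp [Lm, Pi.single_apply]

/-- Gaussian Poincaré inequality (in pair form). -/
lemma poincare_pi (m : ℕ) : ∀ (f : (Fin m → ℝ) → ℝ), ContDiff ℝ 1 f →
    ∫⁻ x, ∫⁻ y, ENNReal.ofReal ((f x - f y) ^ 2) ∂(gaussM m) ∂(gaussM m) ≤
      2 * ∑ i, ∫⁻ x, ENNReal.ofReal (pgrad f x i ^ 2) ∂(gaussM m) := by
  induction m with
  | zero =>
    intro f _
    have : ∀ x y, f x - f y = 0 := fun x y => by rw [Subsingleton.elim x y, sub_self]
    simp [this]
  | succ m ih =>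
    intro f hf
    have hc := cons_pres m
    have hfm : Measurable f := hf.continuous.measurable
    have hpm : ∀ i, Measurable (fun x => ENNReal.ofReal (pgrad f x i ^ 2)) := fun i =>
      ((pgrad_cont hf i).pow 2).measurable.ennreal_ofReal
    have hFm : Measurable (fun p : ℝ × (Fin m → ℝ) => f (Fin.cons p.1 p.2)) :=
      hfm.comp hc.measurable
    have hlhs : ∫⁻ x, ∫⁻ y, ENNReal.ofReal ((f x - f y) ^ 2) ∂(gaussM (m + 1)) ∂(gaussM (m + 1)) =
        ∫⁻ p : ℝ × (Fin m → ℝ), ∫⁻ q : ℝ × (Fin m → ℝ),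
          ENNReal.ofReal ((f (Fin.cons p.1 p.2) - f (Fin.cons q.1 q.2)) ^ 2)
          ∂((gaussianReal 0 1).prod (gaussM m)) ∂((gaussianReal 0 1).prod (gaussM m)) := by
      rw [← hc.lintegral_comp (Measurable.lintegral_prod_right'
        (f := fun r : (Fin (m + 1) → ℝ) × (Fin (m + 1) → ℝ) =>
          ENNReal.ofReal ((f r.1 - f r.2) ^ 2)) (by fun_prop))]
      refine lintegral_congr fun p => ?_
      exact (hc.lintegral_comp (by fun_prop)).symm
    rw [hlhs]
    refine (efron_two (gaussianReal 0 1) (gaussM m) _ hFm).trans ?_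
    have hpc : ∀ i, Measurable (fun p : ℝ × (Fin m → ℝ) =>
        ENNReal.ofReal (pgrad f (Fin.cons p.1 p.2) i ^ 2)) := fun i => (hpm i).comp hc.measurable
    rw [Fin.sum_univ_succ, mul_add]
    refine add_le_add ?_ ?_
    · rw [← hc.lintegral_comp (hpm 0), lintegral_prod_symm _ (hpc 0).aemeasurable,
        ← lintegral_const_mul]
      · refine lintegral_mono fun b => ?_
        refine poincare_one (fun a => f (Fin.cons a b)) (fun a => pgrad f (Fin.cons a b) 0)
          (fun a => cons_slice_one hf b a) ((pgrad_cont hf 0).comp ?_)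
        refine continuous_pi fun i => ?_
        refine Fin.cases ?_ (fun i => ?_) i
        · simpa using continuous_id'
        · simpa using continuous_const
      · exact (hpc 0).lintegral_prod_left'
    · have : ∀ i : Fin m, ∫⁻ x, ENNReal.ofReal (pgrad f x i.succ ^ 2) ∂(gaussM (m + 1)) =
          ∫⁻ a, ∫⁻ b, ENNReal.ofReal (pgrad f (Fin.cons a b) i.succ ^ 2) ∂(gaussM m)
            ∂(gaussianReal 0 1) := fun i => by
        rw [← hc.lintegral_comp (hpm i.succ),
          lintegral_prod _ (hpc i.succ).aemeasurable]
      simp_rw [this]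
      have hmm : ∀ i : Fin m, Measurable fun a : ℝ =>
          ∫⁻ b, ENNReal.ofReal (pgrad f (Fin.cons a b) i.succ ^ 2) ∂(gaussM m) := fun i =>
        (hpc i.succ).lintegral_prod_right'
      rw [← lintegral_finsetSum _ (fun i _ => hmm i),
        ← lintegral_const_mul _ (Finset.measurable_fun_sum _ fun i _ => hmm i)]
      refine lintegral_mono fun a => ?_
      have h := cons_slice_rest hf a
      have h' := ih _ h.1
      simp_rw [h.2] at h'
      exact h'

lemma lin_alg (k m : ℕ) (W Wh C : Matrix (Fin (k + m)) (Fin (k + m)) ℝ) (hW : Wᵀ * W = 1)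
    (hWh : Whᵀ * Wh = 1) (Λ : Fin (k + m) → ℝ) (hΛ : ∀ i, 0 ≤ Λ i)
    (hC : C = W * Matrix.diagonal Λ * Wᵀ) (ε : ℝ) (hε : 0 < ε) (hp : ‖W - Wh‖ ≤ ε) :
    ∑ j : Fin m, (Whᵀ * C * Wh) (Fin.natAdd k j) (Fin.natAdd k j) ≤
      (ε * Real.sqrt (∑ j : Fin k, Λ (Fin.castAdd m j)) +
          Real.sqrt (∑ j : Fin m, Λ (Fin.natAdd k j))) ^ 2 := by
  have hWh2 : Wh * Whᵀ = 1 := mul_eq_one_comm.1 hWh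
  -- Bessel
  have bessel : ∀ v : Fin (k + m) → ℝ,
      ∑ j : Fin m, ((Whᵀ *ᵥ v) (Fin.natAdd k j)) ^ 2 ≤ ∑ i, v i ^ 2 := by
    intro v
    have h1 : ∑ i, (Whᵀ *ᵥ v) i ^ 2 = ∑ i, v i ^ 2 := by
      have : (Whᵀ *ᵥ v) ⬝ᵥ (Whᵀ *ᵥ v) = v ⬝ᵥ v := by
        rw [dotProduct_mulVec, vecMul_transpose, mulVec_mulVec, hWh2, one_mulVec]
      simpa [dotProduct, sq] using this
    rw [← h1, Fin.sum_univ_add]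
    have : 0 ≤ ∑ i : Fin k, (Whᵀ *ᵥ v) (Fin.castAdd m i) ^ 2 :=
      Finset.sum_nonneg fun i _ => sq_nonneg _
    linarith
  have hA : ∀ j, (Whᵀ * C * Wh) j j = ∑ i, Λ i * ((Whᵀ * W) j i) ^ 2 := by
    intro j
    have : Whᵀ * C * Wh = (Whᵀ * W) * Matrix.diagonal Λ * (Whᵀ * W)ᵀ := by
      rw [hC, transpose_mul, transpose_transpose]; simp only [Matrix.mul_assoc]
    rw [this, Matrix.mul_apply]
    refine Finset.sum_congr rfl fun i _ => ?_
    rw [Matrix.mul_diagonal, transpose_apply]; ring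
  have hcol : ∀ (M : Matrix (Fin (k + m)) (Fin (k + m)) ℝ) j i,
      (Whᵀ * M) j i = (Whᵀ *ᵥ (fun l => M l i)) j := fun M j i => rfl
  have hlo : ∀ i : Fin (k + m), ∑ j : Fin m, ((Whᵀ * W) (Fin.natAdd k j) i) ^ 2 ≤ 1 := by
    intro i
    simp only [hcol]
    refine (bessel _).trans (le_of_eq ?_)
    have := congrFun (congrFun hW i) i
    simpa [Matrix.mul_apply, sq] using this
  have hhi : ∀ i : Fin k,
      ∑ j : Fin m, ((Whᵀ * W) (Fin.natAdd k j) (Fin.castAdd m i)) ^ 2 ≤ ε ^ 2 := by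
    intro i
    have e : ∀ j : Fin m, (Whᵀ * W) (Fin.natAdd k j) (Fin.castAdd m i) =
        (Whᵀ * (W - Wh)) (Fin.natAdd k j) (Fin.castAdd m i) := by
      intro j
      rw [Matrix.mul_sub, hWh, Matrix.sub_apply, Matrix.one_apply_ne, sub_zero]
      intro h
      have := congrArg Fin.val h
      simp at this
      omega
    simp only [e, hcol]
    refine (bessel _).trans ?_
    have h1 := Matrix.l2_opNorm_mulVec (W - Wh) (EuclideanSpace.single (Fin.castAdd m i) (1 : ℝ))
    have h2 : ‖WithLp.toLp 2 ((W - Wh) *ᵥ (Pi.single (Fin.castAdd m i) (1 : ℝ)))‖ ≤ ε := by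
      refine le_trans ?_ (h1.trans ?_)
      · exact le_of_eq rfl
      · simpa using hp
    have h3 := pow_le_pow_left₀ (norm_nonneg _) h2 2
    rw [EuclideanSpace.norm_sq_eq] at h3
    simpa using h3
  have hsum : ∑ j : Fin m, (Whᵀ * C * Wh) (Fin.natAdd k j) (Fin.natAdd k j) =
      ∑ i, Λ i * ∑ j : Fin m, ((Whᵀ * W) (Fin.natAdd k j) i) ^ 2 := by
    simp only [hA, Finset.mul_sum]
    exact Finset.sum_comm
  rw [hsum, Fin.sum_univ_add]
  set a := ∑ j : Fin k, Λ (Fin.castAdd m j) with ha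
  set b := ∑ j : Fin m, Λ (Fin.natAdd k j) with hb
  have ha0 : 0 ≤ a := Finset.sum_nonneg fun i _ => hΛ _
  have hb0 : 0 ≤ b := Finset.sum_nonneg fun i _ => hΛ _
  have h1 : ∑ i : Fin k, Λ (Fin.castAdd m i) *
      ∑ j : Fin m, ((Whᵀ * W) (Fin.natAdd k j) (Fin.castAdd m i)) ^ 2 ≤ ε ^ 2 * a := by
    rw [ha, Finset.mul_sum]
    refine Finset.sum_le_sum fun i _ => ?_
    rw [mul_comm (ε ^ 2)]
    exact mul_le_mul_of_nonneg_left (hhi i) (hΛ _)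
  have h2 : ∑ i : Fin m, Λ (Fin.natAdd k i) *
      ∑ j : Fin m, ((Whᵀ * W) (Fin.natAdd k j) (Fin.natAdd k i)) ^ 2 ≤ b := by
    rw [hb]
    refine Finset.sum_le_sum fun i _ => ?_
    exact mul_le_of_le_one_right (hΛ _) (hlo _)
  have h3 : (ε * Real.sqrt a + Real.sqrt b) ^ 2 =
      ε ^ 2 * a + b + 2 * (ε * Real.sqrt a * Real.sqrt b) := by
    rw [add_sq, mul_pow, Real.sq_sqrt ha0, Real.sq_sqrt hb0]
    ring
  have h4 : 0 ≤ ε * Real.sqrt a * Real.sqrt b := by positivity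
  linarith

lemma memLp_two_of_lintegral {α : Type*} [MeasurableSpace α] (μ : Measure α) (F : α → ℝ)
    (hF : Measurable F) (h : ∫⁻ x, ENNReal.ofReal (F x ^ 2) ∂μ ≠ ⊤) : MemLp F 2 μ := by
  rw [memLp_two_iff_integrable_sq hF.aestronglyMeasurable]
  refine ⟨(hF.pow_const 2).aestronglyMeasurable, ?_⟩
  rw [hasFiniteIntegral_iff_ofReal (Filter.Eventually.of_forall fun x => sq_nonneg _)]
  exact h.lt_top

lemma integral_sq_sub {α : Type*} [MeasurableSpace α] (μ : Measure α) [IsProbabilityMeasure μ]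
    (F : α → ℝ) (hF : MemLp F 2 μ) (c : ℝ) (h0 : ∫ x, F x ∂μ = 0) :
    ∫ x, (c - F x) ^ 2 ∂μ = c ^ 2 + ∫ x, F x ^ 2 ∂μ := by
  have hi : Integrable F μ := hF.integrable (by norm_num)
  have e : (fun x => (c - F x) ^ 2) = fun x => (c ^ 2 - 2 * c * F x) + F x ^ 2 := by
    funext x; ring
  have hi2 : Integrable (fun x => c ^ 2 - 2 * c * F x) μ :=
    (integrable_const _).sub (hi.const_mul _)
  rw [e, integral_add hi2 hF.integrable_sq,
    integral_sub (integrable_const _) (hi.const_mul _), integral_const_mul, h0]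
  simp

lemma lintegral_sq_sub {α : Type*} [MeasurableSpace α] (μ : Measure α) [IsProbabilityMeasure μ]
    (F : α → ℝ) (hF : MemLp F 2 μ) (c : ℝ) (h0 : ∫ x, F x ∂μ = 0) :
    ∫⁻ x, ENNReal.ofReal ((c - F x) ^ 2) ∂μ =
      ENNReal.ofReal (c ^ 2) + ∫⁻ x, ENNReal.ofReal (F x ^ 2) ∂μ := by
  have hs : Integrable (fun x => (c - F x) ^ 2) μ := ((memLp_const c).sub hF).integrable_sq
  rw [← ofReal_integral_eq_lintegral_ofReal hs
      (Filter.Eventually.of_forall fun x => sq_nonneg _),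
    ← ofReal_integral_eq_lintegral_ofReal hF.integrable_sq
      (Filter.Eventually.of_forall fun x => sq_nonneg _),
    ← ENNReal.ofReal_add (sq_nonneg _) (integral_nonneg fun x => sq_nonneg _)]
  congr 1
  exact integral_sq_sub μ F hF c h0

lemma var_le_pairs {α : Type*} [MeasurableSpace α] (μ : Measure α) [IsProbabilityMeasure μ]
    (F : α → ℝ) (hF : Measurable F) :
    2 * ∫⁻ x, ENNReal.ofReal ((F x - ∫ y, F y ∂μ) ^ 2) ∂μ ≤
      ∫⁻ x, ∫⁻ y, ENNReal.ofReal ((F x - F y) ^ 2) ∂μ ∂μ := by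
  by_cases htop : ∫⁻ x, ∫⁻ y, ENNReal.ofReal ((F x - F y) ^ 2) ∂μ ∂μ = ⊤
  · rw [htop]; exact le_top
  have hm : Measurable (fun x => ∫⁻ y, ENNReal.ofReal ((F x - F y) ^ 2) ∂μ) :=
    Measurable.lintegral_prod_right'
      (f := fun r : α × α => ENNReal.ofReal ((F r.1 - F r.2) ^ 2)) (by fun_prop)
  obtain ⟨x0, hx0⟩ := (ae_lt_top hm htop).exists
  have hL0 : MemLp (fun y => F x0 - F y) 2 μ :=
    memLp_two_of_lintegral μ _ (by fun_prop) hx0.ne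
  have hL : MemLp F 2 μ := by
    have := (memLp_const (F x0)).sub hL0
    refine this.ae_eq (Filter.Eventually.of_forall fun x => ?_)
    simp
  set c := ∫ y, F y ∂μ with hc
  have hLc : MemLp (fun y => F y - c) 2 μ := hL.sub (memLp_const c)
  have h0 : ∫ y, (F y - c) ∂μ = 0 := by
    rw [integral_sub (hL.integrable (by norm_num)) (integrable_const _)]
    simp [hc]
  have : ∀ x, ∫⁻ y, ENNReal.ofReal ((F x - F y) ^ 2) ∂μ =
      ENNReal.ofReal ((F x - c) ^ 2) + ∫⁻ y, ENNReal.ofReal ((F y - c) ^ 2) ∂μ := by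
    intro x
    rw [← lintegral_sq_sub μ (fun y => F y - c) hLc (F x - c) h0]
    refine lintegral_congr fun y => ?_
    congr 2; ring
  simp_rw [this]
  rw [lintegral_add_right _ measurable_const]
  simp [two_mul]

lemma mc_lemma {Ω E : Type*} [MeasurableSpace Ω] [MeasurableSpace E] (P : Measure Ω)
    [IsProbabilityMeasure P] (ν : Measure E) [IsProbabilityMeasure ν] (N : ℕ) (hN : 1 ≤ N)
    (Z : Fin N → Ω → E) (hZm : ∀ j, Measurable (Z j)) (hlaw : ∀ j, Measure.map (Z j) P = ν)
    (hind : iIndepFun Z P) (h : E → ℝ) (hh : Measurable h)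
    (hv : ∫⁻ z, ENNReal.ofReal ((h z - ∫ z, h z ∂ν) ^ 2) ∂ν ≠ ⊤) :
    Integrable (fun ω => (N : ℝ)⁻¹ * ∑ j, h (Z j ω)) P ∧
    ∫ ω, (N : ℝ)⁻¹ * ∑ j, h (Z j ω) ∂P = ∫ z, h z ∂ν ∧
    ∫⁻ ω, ENNReal.ofReal (((N : ℝ)⁻¹ * ∑ j, h (Z j ω) - ∫ z, h z ∂ν) ^ 2) ∂P =
      ENNReal.ofReal ((N : ℝ)⁻¹) * ∫⁻ z, ENNReal.ofReal ((h z - ∫ z, h z ∂ν) ^ 2) ∂ν := by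
  set c := ∫ z, h z ∂ν with hc
  have hNr : (N : ℝ) ≠ 0 := by positivity
  have hLc : MemLp (fun z => h z - c) 2 ν := memLp_two_of_lintegral ν _ (by fun_prop) hv
  have hL : MemLp h 2 ν := by
    refine (hLc.add (memLp_const c)).ae_eq (Filter.Eventually.of_forall fun x => ?_)
    simp
  have hmp : ∀ j, MeasurePreserving (Z j) P ν := fun j => ⟨hZm j, hlaw j⟩
  have hLj : ∀ j, MemLp (fun ω => h (Z j ω)) 2 P := fun j => hL.comp_measurePreserving (hmp j)
  have hij : ∀ j, Integrable (fun ω => h (Z j ω)) P := fun j => (hLj j).integrable (by norm_num)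
  have hEj : ∀ j, ∫ ω, h (Z j ω) ∂P = c := fun j => by
    rw [hc, ← hlaw j, integral_map (hZm j).aemeasurable hh.aestronglyMeasurable]
  have hmean : ∫ ω, (N : ℝ)⁻¹ * ∑ j, h (Z j ω) ∂P = c := by
    rw [integral_const_mul, integral_finsetSum _ (fun j _ => hij j)]
    simp [hEj, hNr]
  have hLs : MemLp (fun ω => (N : ℝ)⁻¹ * ∑ j, h (Z j ω)) 2 P :=
    (memLp_finsetSum _ (fun j _ => hLj j)).const_mul _
  refine ⟨hLs.integrable (by norm_num), hmean, ?_⟩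
  have hsub : MemLp (fun ω => (N : ℝ)⁻¹ * ∑ j, h (Z j ω) - c) 2 P := hLs.sub (memLp_const c)
  rw [← ofReal_integral_eq_lintegral_ofReal hsub.integrable_sq
      (Filter.Eventually.of_forall fun x => sq_nonneg _),
    ← ofReal_integral_eq_lintegral_ofReal hLc.integrable_sq
      (Filter.Eventually.of_forall fun x => sq_nonneg _),
    ← ENNReal.ofReal_mul (by positivity)]
  congr 1
  have hvar : variance (∑ j, fun ω => h (Z j ω)) P = ∑ j, variance (fun ω => h (Z j ω)) P := by
    refine IndepFun.variance_sum (fun j _ => hLj j) ?_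
    intro i _ j _ hij
    exact (hind.indepFun hij).comp hh hh
  have hvj : ∀ j, variance (fun ω => h (Z j ω)) P = ∫ z, (h z - c) ^ 2 ∂ν := by
    intro j
    rw [variance_eq_integral (hLj j).aestronglyMeasurable.aemeasurable, hEj, ← hlaw j,
      integral_map (hZm j).aemeasurable (by fun_prop)]
  have hS : variance (fun ω => (N : ℝ)⁻¹ * (∑ j, fun ω => h (Z j ω)) ω) P =
      ∫ ω, ((N : ℝ)⁻¹ * ∑ j, h (Z j ω) - c) ^ 2 ∂P := by
    have e : (fun ω => (N : ℝ)⁻¹ * (∑ j, fun ω => h (Z j ω)) ω) =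
      fun ω => (N : ℝ)⁻¹ * ∑ j, h (Z j ω) := by funext ω; simp
    rw [e, variance_eq_integral hLs.aestronglyMeasurable.aemeasurable, hmean]
  rw [← hS, variance_const_mul, hvar]
  simp only [hvj, Finset.sum_const, Finset.card_univ, Fintype.card_fin, nsmul_eq_mul]
  field_simp

lemma jensen_exp {α : Type*} [MeasurableSpace α] (μ : Measure α) [IsProbabilityMeasure μ]
    (u : α → ℝ) (hu : Integrable u μ) (hu0 : ∀ x, 0 ≤ u x) :
    Real.exp (-∫ x, u x ∂μ) ≤ ∫ x, Real.exp (-u x) ∂μ := by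
  set A := ∫ x, u x ∂μ with hA
  have hi : Integrable (fun x => Real.exp (-u x)) μ := by
    refine Integrable.of_bound
      (Real.continuous_exp.comp_aestronglyMeasurable hu.aestronglyMeasurable.neg) 1
      (Filter.Eventually.of_forall fun x => ?_)
    rw [Real.norm_eq_abs, abs_of_pos (Real.exp_pos _)]
    exact Real.exp_le_one_iff.2 (by simpa using hu0 x)
  have h1 : ∫ x, Real.exp (-A) * (1 - (u x - A)) ∂μ = Real.exp (-A) := by
    have hi2 : Integrable (fun x => u x - A) μ := hu.sub (integrable_const _)
    rw [integral_const_mul, integral_sub (integrable_const _) hi2,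
      integral_sub hu (integrable_const _)]
    simp [← hA]
  rw [← h1]
  refine integral_mono
    (((integrable_const _).sub (hu.sub (integrable_const _))).const_mul _) hi fun x => ?_
  have : Real.exp (-u x) = Real.exp (-A) * Real.exp (-(u x - A)) := by
    rw [← Real.exp_add]; congr 1; ring
  simp only [this]
  have h2 := Real.add_one_le_exp (-(u x - A))
  exact mul_le_mul_of_nonneg_left (by linarith) (Real.exp_pos _).le

lemma exp_half_diff {s t : ℝ} (hs : 0 ≤ s) (ht : 0 ≤ t) :
    (Real.exp (-s / 2) - Real.exp (-t / 2)) ^ 2 ≤ (s - t) ^ 2 / 4 := by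
  have key : ∀ s t : ℝ, 0 ≤ s → s ≤ t →
      (Real.exp (-s / 2) - Real.exp (-t / 2)) ^ 2 ≤ (s - t) ^ 2 / 4 := by
    intro s t hs hst
    have h1 : Real.exp (-t / 2) = Real.exp (-s / 2) * Real.exp (-(t - s) / 2) := by
      rw [← Real.exp_add]; congr 1; ring
    have h2 := Real.add_one_le_exp (-(t - s) / 2)
    have h3 : Real.exp (-s / 2) ≤ 1 := Real.exp_le_one_iff.2 (by linarith)
    have h4 : Real.exp (-(t - s) / 2) ≤ 1 := Real.exp_le_one_iff.2 (by linarith)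
    have h5 := Real.exp_pos (-s / 2)
    have h6 : 0 ≤ Real.exp (-s / 2) - Real.exp (-t / 2) := by rw [h1]; nlinarith
    have h7 : Real.exp (-s / 2) - Real.exp (-t / 2) ≤ (t - s) / 2 := by rw [h1]; nlinarith
    nlinarith
  rcases le_total s t with h | h
  · exact key s t hs h
  · have := key t s ht h
    nlinarith

set_option maxHeartbeats 1000000 in
lemma hell_bound {α : Type*} [MeasurableSpace α] (μ : Measure α) [IsProbabilityMeasure μ]
    (u v : α → ℝ) (hu : Integrable u μ) (hv : Integrable v μ) (hu0 : ∀ x, 0 ≤ u x)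
    (hv0 : ∀ x, 0 ≤ v x) (hD : Integrable (fun x => (u x - v x) ^ 2) μ) (L : ℝ)
    (hL : L ^ 2 = (1 / 8) * ((∫ x, Real.exp (-u x) ∂μ) *
      Real.exp (-∫ x, u x ∂μ)) ^ (-(1 / 2 : ℝ))) (d : ℝ)
    (hd : d = Real.sqrt ((1 / 2) * ∫ x, (Real.sqrt (Real.exp (-u x) / ∫ x, Real.exp (-u x) ∂μ) -
      Real.sqrt (Real.exp (-v x) / ∫ x, Real.exp (-v x) ∂μ)) ^ 2 ∂μ)) :
    1 / 8 ≤ L ^ 2 ∧ d ^ 2 ≤ 1 ∧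
    d ^ 2 ≤ L ^ 2 * (∫ x, (u x - v x) ^ 2 ∂μ) *
      Real.exp (((∫ x, v x ∂μ) - ∫ x, u x ∂μ) / 2) ∧
    d ^ 2 ≤ L ^ 2 * (∫ x, (u x - v x) ^ 2 ∂μ) * 2 := by
  have jA := jensen_exp μ u hu hu0
  have jB := jensen_exp μ v hv hv0
  have bd : ∀ w : α → ℝ, Integrable w μ → (∀ x, 0 ≤ w x) →
      MemLp (fun x => Real.exp (-w x / 2)) 2 μ := by
    intro w hw hw0
    refine MemLp.of_bound (Real.continuous_exp.comp_aestronglyMeasurable ?_) 1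
      (Filter.Eventually.of_forall fun x => ?_)
    · exact (hw.neg.div_const 2).aestronglyMeasurable
    · rw [Real.norm_eq_abs, abs_of_pos (Real.exp_pos _)]
      exact Real.exp_le_one_iff.2 (by have := hw0 x; linarith)
  have sqe : ∀ t : ℝ, Real.exp (-t / 2) ^ 2 = Real.exp (-t) := fun t => by
    rw [sq, ← Real.exp_add]; congr 1; ring
  have mu := bd u hu hu0
  have mv := bd v hv hv0
  set A := ∫ x, u x ∂μ with hA
  set B := ∫ x, v x ∂μ with hB
  set D := ∫ x, (u x - v x) ^ 2 ∂μ with hDdef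
  set Zu := ∫ x, Real.exp (-u x) ∂μ with hZu
  set Zv := ∫ x, Real.exp (-v x) ∂μ with hZv
  set I := ∫ x, Real.exp (-u x / 2) * Real.exp (-v x / 2) ∂μ with hI
  have hZu0 : 0 < Zu := (Real.exp_pos _).trans_le jA
  have hZv0 : 0 < Zv := (Real.exp_pos _).trans_le jB
  have hA0 : 0 ≤ A := integral_nonneg hu0
  have hI0 : 0 ≤ I := integral_nonneg fun x => by positivity
  have hmulint : Integrable (fun x => Real.exp (-u x / 2) * Real.exp (-v x / 2)) μ :=
    mu.integrable_mul mv
  have iu : Integrable (fun x => Real.exp (-u x)) μ := by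
    simpa only [sqe] using mu.integrable_sq
  have iv : Integrable (fun x => Real.exp (-v x)) μ := by
    simpa only [sqe] using mv.integrable_sq
  have hZu1 : Zu ≤ 1 := by
    have : ∫ x, Real.exp (-u x) ∂μ ≤ ∫ x, (1 : ℝ) ∂μ :=
      integral_mono iu (integrable_const _) fun x =>
        Real.exp_le_one_iff.2 (by simpa using hu0 x)
    simpa using this
  set p := Real.sqrt Zu with hp
  set q := Real.sqrt Zv with hq
  have hp0 : 0 < p := Real.sqrt_pos.2 hZu0
  have hq0 : 0 < q := Real.sqrt_pos.2 hZv0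
  have hp2 : p ^ 2 = Zu := Real.sq_sqrt hZu0.le
  have hq2 : q ^ 2 = Zv := Real.sq_sqrt hZv0.le
  have hpA : Real.exp (-A / 2) ≤ p := by
    rw [← sq_le_sq₀ (Real.exp_pos _).le hp0.le, sqe, hp2]; exact jA
  have hqB : Real.exp (-B / 2) ≤ q := by
    rw [← sq_le_sq₀ (Real.exp_pos _).le hq0.le, sqe, hq2]; exact jB
  -- expansions
  have hlin : ∀ a b : ℝ, ∫ x, (a * Real.exp (-u x / 2) - b * Real.exp (-v x / 2)) ^ 2 ∂μ =
      a ^ 2 * Zu + b ^ 2 * Zv - 2 * a * b * I := by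
    intro a b
    have e : (fun x => (a * Real.exp (-u x / 2) - b * Real.exp (-v x / 2)) ^ 2) = fun x =>
        (a ^ 2 * Real.exp (-u x) + b ^ 2 * Real.exp (-v x)) -
          2 * a * b * (Real.exp (-u x / 2) * Real.exp (-v x / 2)) := by
      funext x; rw [← sqe, ← sqe]; ring
    have hi2 : Integrable (fun x => a ^ 2 * Real.exp (-u x) + b ^ 2 * Real.exp (-v x)) μ :=
      (iu.const_mul _).add (iv.const_mul _)
    rw [e, integral_sub hi2 (hmulint.const_mul _),
      integral_add (iu.const_mul _) (iv.const_mul _), integral_const_mul, integral_const_mul,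
      integral_const_mul]
  have hsq : ∀ t Zt : ℝ, 0 < Zt → Real.sqrt (Real.exp (-t) / Zt) =
      (Real.sqrt Zt)⁻¹ * Real.exp (-t / 2) := by
    intro t Zt hZt
    rw [Real.sqrt_div (Real.exp_pos _).le, ← sqe, Real.sqrt_sq (Real.exp_pos _).le]
    ring
  have hd2 : d ^ 2 = 1 - I / (p * q) := by
    have e : (fun x => (Real.sqrt (Real.exp (-u x) / Zu) -
      Real.sqrt (Real.exp (-v x) / Zv)) ^ 2) = fun x =>
        (p⁻¹ * Real.exp (-u x / 2) - q⁻¹ * Real.exp (-v x / 2)) ^ 2 := by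
      funext x; rw [hsq _ _ hZu0, hsq _ _ hZv0]
    rw [hd, Real.sq_sqrt (mul_nonneg (by norm_num) (integral_nonneg fun x => sq_nonneg _)), e,
      hlin, ← hp2, ← hq2]
    field_simp
    ring
  have hDle : p ^ 2 + q ^ 2 - 2 * I ≤ D / 4 := by
    have h1 := hlin 1 1
    have h2 : ∫ x, (1 * Real.exp (-u x / 2) - 1 * Real.exp (-v x / 2)) ^ 2 ∂μ ≤
        ∫ x, (u x - v x) ^ 2 / 4 ∂μ := by
      refine integral_mono ((mu.const_mul 1).sub (mv.const_mul 1)).integrable_sq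
        (hD.div_const 4) fun x => ?_
      simpa using exp_half_diff (hu0 x) (hv0 x)
    rw [integral_div, h1] at h2
    rw [hp2, hq2]; linarith
  obtain ⟨c, hc⟩ : ∃ c, c = I / (p * q) := ⟨_, rfl⟩
  have hIc : I = c * (p * q) := by rw [hc]; field_simp
  have hc0 : 0 ≤ c := by rw [hc]; positivity
  have hc1 : c ≤ 1 := by have := sq_nonneg d; rw [hd2, ← hc] at this; linarith
  have hLe : L ^ 2 = (1 / 8) * (Real.exp (A / 2) / p) := by
    rw [hL, ← hp2, Real.mul_rpow (by positivity) (Real.exp_pos _).le, ← Real.exp_mul,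
      ← Real.rpow_natCast, ← Real.rpow_mul hp0.le]
    have e1 : ((2 : ℕ) : ℝ) * (-(1 / 2 : ℝ)) = -1 := by norm_num
    have e2 : -A * (-(1 / 2 : ℝ)) = A / 2 := by ring
    rw [e1, e2, Real.rpow_neg_one]; ring
  have hA1 : 1 ≤ Real.exp (A / 2) := Real.one_le_exp (by linarith)
  have hp1 : p ≤ 1 := by rw [hp]; exact Real.sqrt_le_one.2 hZu1
  have hpe : 1 ≤ Real.exp (A / 2) * p := by
    have : Real.exp (A / 2) * Real.exp (-A / 2) = 1 := by
      rw [← Real.exp_add]; simp [neg_div]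
    nlinarith
  have hqe : 1 ≤ Real.exp (B / 2) * q := by
    have : Real.exp (B / 2) * Real.exp (-B / 2) = 1 := by
      rw [← Real.exp_add]; simp [neg_div]
    nlinarith [Real.exp_pos (B / 2)]
  have hD0 : 0 ≤ D := integral_nonneg fun x => sq_nonneg _
  rw [hIc] at hDle
  refine ⟨?_, ?_, ?_, ?_⟩
  · rw [hLe]
    have : 1 ≤ Real.exp (A / 2) / p := by rw [le_div_iff₀ hp0]; linarith
    linarith
  · rw [hd2, ← hc]; linarith
  · rw [hd2, ← hc]
    have e : L ^ 2 * D * Real.exp ((B - A) / 2) = D / 8 * Real.exp (B / 2) / p := by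
      have : Real.exp (B / 2) = Real.exp (A / 2) * Real.exp ((B - A) / 2) := by
        rw [← Real.exp_add]; congr 1; ring
      rw [hLe, this]; ring
    rw [e, le_div_iff₀ hp0]
    have h1 : (1 - c) * p * q ≤ D / 8 := by nlinarith [sq_nonneg (p - q)]
    have h2 : 0 ≤ (1 - c) * p := mul_nonneg (by linarith) hp0.le
    calc (1 - c) * p ≤ (1 - c) * p * (Real.exp (B / 2) * q) := le_mul_of_one_le_right h2 hqe
      _ = (1 - c) * p * q * Real.exp (B / 2) := by ring
      _ ≤ _ := mul_le_mul_of_nonneg_right h1 (Real.exp_pos _).le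
  · rw [hd2, ← hc]
    have e : L ^ 2 * D * 2 = D / 4 * Real.exp (A / 2) / p := by rw [hLe]; ring
    rw [e, le_div_iff₀ hp0]
    have h1 : (1 - c) * p * p ≤ D / 4 := by
      have : (1 - c) * p * p ≤ p ^ 2 + q ^ 2 - 2 * (c * (p * q)) := by
        have e3 : p ^ 2 + q ^ 2 - 2 * (c * (p * q)) - (1 - c) * p * p =
          (q - c * p) ^ 2 + c * (1 - c) * p ^ 2 := by ring
        have e4 : 0 ≤ c * (1 - c) * p ^ 2 :=
          mul_nonneg (mul_nonneg hc0 (sub_nonneg.2 hc1)) (sq_nonneg p)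
        linarith [sq_nonneg (q - c * p)]
      linarith
    have h2 : 0 ≤ (1 - c) * p := mul_nonneg (by linarith) hp0.le
    calc (1 - c) * p ≤ (1 - c) * p * (Real.exp (A / 2) * p) := le_mul_of_one_le_right h2 hpe
      _ = (1 - c) * p * p * Real.exp (A / 2) := by ring
      _ ≤ _ := mul_le_mul_of_nonneg_right h1 (Real.exp_pos _).le

lemma prod_L2 {X Ω : Type*} [MeasurableSpace X] [MeasurableSpace Ω] (μ : Measure X)
    [IsProbabilityMeasure μ] (P : Measure Ω) [IsProbabilityMeasure P] (K : X × Ω → ℝ)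
    (hK : Measurable K) (T : ℝ) (hT : 0 ≤ T)
    (h : ∫⁻ x, ∫⁻ ω, ENNReal.ofReal (K (x, ω) ^ 2) ∂P ∂μ ≤ ENNReal.ofReal T) :
    MemLp K 2 (μ.prod P) ∧ ∫ p, K p ^ 2 ∂(μ.prod P) ≤ T := by
  have h1 : ∫⁻ p, ENNReal.ofReal (K p ^ 2) ∂(μ.prod P) ≤ ENNReal.ofReal T := by
    rwa [lintegral_prod _ (by fun_prop)]
  have hm := memLp_two_of_lintegral (μ.prod P) K hK (h1.trans_lt ENNReal.ofReal_lt_top).ne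
  refine ⟨hm, ?_⟩
  rw [← ofReal_integral_eq_lintegral_ofReal hm.integrable_sq
      (Filter.Eventually.of_forall fun x => sq_nonneg _)] at h1
  exact (ENNReal.ofReal_le_ofReal_iff hT).1 h1

lemma min_exp_bound (x c : ℝ) (h1 : c ≤ Real.exp x) (h2 : c ≤ 2) : c ≤ 1 + x + x ^ 2 := by
  by_cases hx : |x| ≤ 1
  · have := Real.abs_exp_sub_one_sub_id_le hx
    have := (abs_le.1 this).2
    linarith
  · push Not at hx
    rcases lt_abs.1 hx with h | h
    · nlinarith
    · have : Real.exp x ≤ 1 := Real.exp_le_one_iff.2 (by linarith)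
      nlinarith

set_option maxHeartbeats 1000000 in
lemma core {X Ω : Type*} [MeasurableSpace X] [MeasurableSpace Ω] (μ : Measure X)
    [IsProbabilityMeasure μ] (P : Measure Ω) [IsProbabilityMeasure P]
    (F Gb : X → ℝ) (G : X → Ω → ℝ) (hF : Measurable F) (hGb : Measurable Gb)
    (hG : Measurable (fun p : X × Ω => G p.1 p.2)) (hF0 : ∀ x, 0 ≤ F x) (hG0 : ∀ x ω, 0 ≤ G x ω)
    (hFi : Integrable F μ) (S h : ℝ) (hS : 0 ≤ S) (hh0 : 0 ≤ h) (hh1 : h ≤ 1)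
    (hFG : ∫⁻ x, ENNReal.ofReal ((F x - Gb x) ^ 2) ∂μ ≤ ENNReal.ofReal S)
    (hmean : ∀ᵐ x ∂μ, Integrable (G x) P ∧ ∫ ω, G x ω ∂P = Gb x)
    (hvar : ∫⁻ x, ∫⁻ ω, ENNReal.ofReal ((G x ω - Gb x) ^ 2) ∂P ∂μ ≤ ENNReal.ofReal (S * h ^ 2))
    (hGF : ∫ x, Gb x ∂μ = ∫ x, F x ∂μ) (L : ℝ) (hLpos : 0 < L)
    (hL : L ^ 2 = (1 / 8) * ((∫ x, Real.exp (-F x) ∂μ) *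
      Real.exp (-∫ x, F x ∂μ)) ^ (-(1 / 2 : ℝ))) (d : Ω → ℝ)
    (hd : ∀ ω, d ω = Real.sqrt ((1 / 2) * ∫ x, (Real.sqrt (Real.exp (-F x) /
        ∫ x, Real.exp (-F x) ∂μ) -
      Real.sqrt (Real.exp (-G x ω) / ∫ x, Real.exp (-G x ω) ∂μ)) ^ 2 ∂μ)) :
    ∫ ω, d ω ∂P ≤ L * (1 + h) * Real.sqrt S := by
  have hGx : ∀ x, Measurable (G x) := fun x => hG.comp measurable_prodMk_left
  have hHm : Measurable (fun p : X × Ω => G p.1 p.2 - Gb p.1) := by fun_prop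
  have hKm : Measurable (fun p : X × Ω => F p.1 - G p.1 p.2) := by fun_prop
  obtain ⟨hHL, hHT⟩ := prod_L2 μ P _ hHm (S * h ^ 2) (by positivity) hvar
  have hfin : ∀ᵐ x ∂μ, ∫⁻ ω, ENNReal.ofReal ((G x ω - Gb x) ^ 2) ∂P < ⊤ := by
    refine ae_lt_top ?_ (hvar.trans_lt ENNReal.ofReal_lt_top).ne
    exact Measurable.lintegral_prod_right'
      (f := fun p : X × Ω => ENNReal.ofReal ((G p.1 p.2 - Gb p.1) ^ 2)) (by fun_prop)
  have hmean0 : ∀ᵐ x ∂μ, ∫ ω, (G x ω - Gb x) ∂P = 0 := by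
    filter_upwards [hmean] with x hx
    rw [integral_sub hx.1 (integrable_const _), hx.2]; simp
  have hKle : ∫⁻ x, ∫⁻ ω, ENNReal.ofReal ((F x - G x ω) ^ 2) ∂P ∂μ ≤
      ENNReal.ofReal (S * (1 + h ^ 2)) := by
    have e : ∀ᵐ x ∂μ, ∫⁻ ω, ENNReal.ofReal ((F x - G x ω) ^ 2) ∂P =
        ENNReal.ofReal ((F x - Gb x) ^ 2) + ∫⁻ ω, ENNReal.ofReal ((G x ω - Gb x) ^ 2) ∂P := by
      filter_upwards [hfin, hmean0] with x hx hx0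
      have hxm : Measurable (fun ω => G x ω - Gb x) := (hGx x).sub_const _
      rw [← lintegral_sq_sub P (fun ω => G x ω - Gb x)
        (memLp_two_of_lintegral P _ hxm hx.ne) (F x - Gb x) hx0]
      refine lintegral_congr fun y => ?_
      congr 2; ring
    rw [lintegral_congr_ae e, lintegral_add_left (by fun_prop)]
    refine (add_le_add hFG hvar).trans (le_of_eq ?_)
    rw [← ENNReal.ofReal_add hS (by positivity)]
    congr 1; ring
  obtain ⟨hKL, hKT⟩ := prod_L2 μ P _ hKm (S * (1 + h ^ 2)) (by positivity) hKle
  have hHi : Integrable (fun p : X × Ω => G p.1 p.2 - Gb p.1) (μ.prod P) :=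
    hHL.integrable (by norm_num)
  have hKi : Integrable (fun p : X × Ω => F p.1 - G p.1 p.2) (μ.prod P) :=
    hKL.integrable (by norm_num)
  have hH2 : Integrable (fun p : X × Ω => (G p.1 p.2 - Gb p.1) ^ 2) (μ.prod P) :=
    hHL.integrable_sq
  have hK2 : Integrable (fun p : X × Ω => (F p.1 - G p.1 p.2) ^ 2) (μ.prod P) :=
    hKL.integrable_sq
  have hFGL : MemLp (fun x => F x - Gb x) 2 μ :=
    memLp_two_of_lintegral μ _ (by fun_prop) (hFG.trans_lt ENNReal.ofReal_lt_top).ne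
  have hGbi : Integrable Gb μ := by
    have := hFi.sub (hFGL.integrable (by norm_num))
    refine this.congr (Filter.Eventually.of_forall fun x => ?_)
    simp
  obtain ⟨D, hD⟩ : ∃ D : Ω → ℝ, D = fun ω => ∫ x, (F x - G x ω) ^ 2 ∂μ := ⟨_, rfl⟩
  obtain ⟨M, hM⟩ : ∃ M : Ω → ℝ, M = fun ω => ∫ x, (G x ω - Gb x) ^ 2 ∂μ := ⟨_, rfl⟩
  obtain ⟨δ, hδ⟩ : ∃ δ : Ω → ℝ, δ = fun ω => ∫ x, (G x ω - Gb x) ∂μ := ⟨_, rfl⟩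
  have iD : Integrable D P := by rw [hD]; exact hK2.integral_prod_right
  have iM : Integrable M P := by rw [hM]; exact hH2.integral_prod_right
  have iδ : Integrable δ P := by rw [hδ]; exact hHi.integral_prod_right
  have eD : ∫ ω, D ω ∂P ≤ S * (1 + h ^ 2) := by
    rw [hD]; rwa [integral_prod_symm _ hK2] at hKT
  have eM : ∫ ω, M ω ∂P ≤ S * h ^ 2 := by
    rw [hM]; rwa [integral_prod_symm _ hH2] at hHT
  have eδ : ∫ ω, δ ω ∂P = 0 := by
    rw [hδ]
    have h1 := integral_prod_symm _ hHi
    rw [integral_prod _ hHi, integral_congr_ae hmean0] at h1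
    simpa using h1.symm
  -- pointwise bounds
  have hpt : ∀ᵐ ω ∂P, 1 / 8 ≤ L ^ 2 ∧ d ω ^ 2 ≤ 1 ∧ 0 ≤ D ω ∧ 0 ≤ 1 + δ ω / 2 + M ω / 4 ∧
      d ω ^ 2 ≤ L ^ 2 * D ω * (1 + δ ω / 2 + M ω / 4) := by
    filter_upwards [hK2.prod_left_ae, hH2.prod_left_ae, hKi.prod_left_ae, hHi.prod_left_ae]
      with ω k2 H2 ki Hi
    have Gi : Integrable (fun x => G x ω) μ := by
      refine (hFi.sub ki).congr (Filter.Eventually.of_forall fun x => ?_)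
      simp
    obtain ⟨b1, b2, b3, b4⟩ := hell_bound μ F (fun x => G x ω) hFi Gi hF0 (fun x => hG0 x ω) k2 L
      hL (d ω) (hd ω)
    have hδe : (∫ x, G x ω ∂μ) - ∫ x, F x ∂μ = δ ω := by
      rw [hδ]; simp only
      rw [integral_sub Gi hGbi, hGF]
    have hDe : ∫ x, (F x - G x ω) ^ 2 ∂μ = D ω := by rw [hD]
    rw [hδe, hDe] at b3
    rw [hDe] at b4
    have hD0 : 0 ≤ D ω := by rw [← hDe]; exact integral_nonneg fun x => sq_nonneg _
    have hHL2 : MemLp (fun x => G x ω - Gb x) 2 μ :=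
      (memLp_two_iff_integrable_sq Hi.aestronglyMeasurable).2 H2
    have hδM : δ ω ^ 2 ≤ M ω := by
      have h1 : 0 ≤ ∫ x, ((G x ω - Gb x) - δ ω) ^ 2 ∂μ := integral_nonneg fun x => sq_nonneg _
      have e : (fun x => ((G x ω - Gb x) - δ ω) ^ 2) = fun x =>
          ((G x ω - Gb x) ^ 2 - 2 * δ ω * (G x ω - Gb x)) + δ ω ^ 2 := by funext x; ring
      have hi2 : Integrable (fun x => (G x ω - Gb x) ^ 2 - 2 * δ ω * (G x ω - Gb x)) μ :=
        H2.sub (Hi.const_mul _)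
      have e1 : ∫ x, (G x ω - Gb x) ∂μ = δ ω := by rw [hδ]
      have e2 : ∫ x, (G x ω - Gb x) ^ 2 ∂μ = M ω := by rw [hM]
      rw [e, integral_add hi2 (integrable_const _), integral_sub H2 (Hi.const_mul _),
        integral_const_mul, e1, e2] at h1
      simp at h1
      nlinarith
    have hx2 : (δ ω / 2) ^ 2 ≤ M ω / 4 := by nlinarith
    have hmin : min (Real.exp (δ ω / 2)) 2 ≤ 1 + δ ω / 2 + M ω / 4 := by
      have := min_exp_bound (δ ω / 2) _ (min_le_left (Real.exp (δ ω / 2)) 2) (min_le_right _ _)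
      linarith
    have hmin0 : 0 ≤ min (Real.exp (δ ω / 2)) 2 := le_min (Real.exp_pos _).le (by norm_num)
    have hLD : 0 ≤ L ^ 2 * D ω := by positivity
    refine ⟨b1, b2, hD0, hmin0.trans hmin, ?_⟩
    refine le_trans ?_ (mul_le_mul_of_nonneg_left hmin hLD)
    rcases min_choice (Real.exp (δ ω / 2)) 2 with h | h
    · rw [h]; exact b3
    · rw [h]; exact b4
  have hd0 : ∀ ω, 0 ≤ d ω := fun ω => by rw [hd]; exact Real.sqrt_nonneg _
  obtain ⟨E, hE⟩ : ∃ E, E = ∫ ω, d ω ∂P := ⟨_, rfl⟩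
  rw [← hE]
  have hE0 : 0 ≤ E := by rw [hE]; exact integral_nonneg hd0
  have hL8 : 1 / 8 ≤ L ^ 2 := by obtain ⟨ω, hω⟩ := hpt.exists; exact hω.1
  have hR0 : 0 ≤ L * (1 + h) * Real.sqrt S := by positivity
  have hE1 : E ≤ 1 := by
    rw [hE]
    have : ∫ ω, d ω ∂P ≤ ∫ ω, (1 : ℝ) ∂P := by
      refine integral_mono_of_nonneg (Filter.Eventually.of_forall hd0) (integrable_const _) ?_
      filter_upwards [hpt] with ω hω
      have := hω.2.1
      have h0 := hd0 ω
      nlinarith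
    simpa using this
  have hquad : ∀ κ : ℝ, 0 ≤ κ →
      2 * κ * E ≤ κ ^ 2 * (L ^ 2 * (S * (1 + h ^ 2))) + (1 + S * h ^ 2 / 4) := by
    intro κ hκ
    have i1 : Integrable (fun ω => κ ^ 2 * L ^ 2 * D ω) P := iD.const_mul _
    have i2 : Integrable (fun ω => δ ω / 2) P := iδ.div_const _
    have i3 : Integrable (fun ω => M ω / 4) P := iM.div_const _
    have i4 : Integrable (fun ω => 1 + δ ω / 2) P := (integrable_const _).add i2
    have i5 : Integrable (fun ω => 1 + δ ω / 2 + M ω / 4) P := i4.add i3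
    have h1 : ∫ ω, 2 * κ * d ω ∂P ≤
        ∫ ω, κ ^ 2 * L ^ 2 * D ω + (1 + δ ω / 2 + M ω / 4) ∂P := by
      refine integral_mono_of_nonneg (Filter.Eventually.of_forall fun ω => ?_) (i1.add i5) ?_
      · have := hd0 ω
        show 0 ≤ 2 * κ * d ω
        positivity
      filter_upwards [hpt] with ω hω
      obtain ⟨_, _, q1, q2, q3⟩ := hω
      set w := 1 + δ ω / 2 + M ω / 4
      have h0 := hd0 ω
      have n1 : 0 ≤ κ ^ 2 * L ^ 2 * D ω := by positivity
      refine (sq_le_sq₀ (by positivity) (by linarith)).1 ?_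
      have n2 : κ ^ 2 * d ω ^ 2 ≤ κ ^ 2 * (L ^ 2 * D ω * w) :=
        mul_le_mul_of_nonneg_left q3 (sq_nonneg _)
      have n3 := sq_nonneg (κ ^ 2 * L ^ 2 * D ω - w)
      have n4 : (κ ^ 2 * L ^ 2 * D ω + w) ^ 2 =
        (κ ^ 2 * L ^ 2 * D ω - w) ^ 2 + 4 * (κ ^ 2 * (L ^ 2 * D ω * w)) := by ring
      have n5 : (2 * κ * d ω) ^ 2 = 4 * (κ ^ 2 * d ω ^ 2) := by ring
      rw [n4, n5]; linarith
    rw [integral_const_mul, ← hE, integral_add i1 i5, integral_add i4 i3,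
      integral_add (integrable_const _) i2, integral_const_mul, integral_div, integral_div,
      eδ] at h1
    simp only [integral_const, probReal_univ, smul_eq_mul, mul_one, zero_div, add_zero] at h1
    have h2 : κ ^ 2 * L ^ 2 * ∫ ω, D ω ∂P ≤ κ ^ 2 * L ^ 2 * (S * (1 + h ^ 2)) :=
      mul_le_mul_of_nonneg_left eD (by positivity)
    linarith
  have hdisc : discrim (L ^ 2 * (S * (1 + h ^ 2))) (-2 * E) (1 + S * h ^ 2 / 4) ≤ 0 := by
    refine discrim_le_zero fun κ => ?_
    rcases le_total 0 κ with hκ | hκ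
    · have := hquad κ hκ
      linarith
    · have n1 : 0 ≤ L ^ 2 * (S * (1 + h ^ 2)) * (κ * κ) :=
        mul_nonneg (by positivity) (mul_self_nonneg _)
      have n2 : 0 ≤ -2 * E * κ := by nlinarith
      have n3 : 0 ≤ 1 + S * h ^ 2 / 4 := by positivity
      linarith
  have hE2 : E ^ 2 ≤ L ^ 2 * S * ((1 + h ^ 2) * (1 + S * h ^ 2 / 4)) := by
    unfold discrim at hdisc
    linarith
  by_cases hbig : 1 ≤ L * (1 + h) * Real.sqrt S
  · linarith
  push Not at hbig
  have hRsq : (L * (1 + h) * Real.sqrt S) ^ 2 = L ^ 2 * (S * (1 + h) ^ 2) := by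
    rw [mul_pow, mul_pow, Real.sq_sqrt hS]; ring
  have hR1 : L ^ 2 * (S * (1 + h) ^ 2) ≤ 1 := by
    rw [← hRsq]; nlinarith
  have hS8 : S * (1 + h) ^ 2 ≤ 8 := by
    have : 0 ≤ S * (1 + h) ^ 2 := by positivity
    nlinarith
  have hfac : (1 + h ^ 2) * (1 + S * h ^ 2 / 4) ≤ (1 + h) ^ 2 := by
    have hp : 0 < (1 + h) ^ 2 := by positivity
    refine le_of_mul_le_mul_right ?_ hp
    have e1 : (1 + h ^ 2) * (1 + S * h ^ 2 / 4) * (1 + h) ^ 2 =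
      (1 + h ^ 2) * ((1 + h) ^ 2 + S * (1 + h) ^ 2 * (h ^ 2 / 4)) := by ring
    have e2 : S * (1 + h) ^ 2 * (h ^ 2 / 4) ≤ 8 * (h ^ 2 / 4) :=
      mul_le_mul_of_nonneg_right hS8 (by positivity)
    have e3 : (1 + h ^ 2) * ((1 + h) ^ 2 + S * (1 + h) ^ 2 * (h ^ 2 / 4)) ≤
      (1 + h ^ 2) * ((1 + h) ^ 2 + 8 * (h ^ 2 / 4)) :=
      mul_le_mul_of_nonneg_left (by linarith) (by positivity)
    have e4 : (1 + h) ^ 2 * (1 + h) ^ 2 - (1 + h ^ 2) * ((1 + h) ^ 2 + 8 * (h ^ 2 / 4)) =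
      2 * h + 2 * h ^ 2 + 2 * h ^ 3 * (1 - h) := by ring
    have e5 : 0 ≤ 2 * h + 2 * h ^ 2 + 2 * h ^ 3 * (1 - h) := by
      have : 0 ≤ 1 - h := by linarith
      positivity
    linarith
  refine (sq_le_sq₀ hE0 hR0).1 ?_
  rw [hRsq]
  have : L ^ 2 * S * ((1 + h ^ 2) * (1 + S * h ^ 2 / 4)) ≤ L ^ 2 * S * (1 + h) ^ 2 :=
    mul_le_mul_of_nonneg_left hfac (by positivity)
  linarith

lemma slice_pgrad {n m : ℕ} (f : (Fin n → ℝ) → ℝ) (hf : ContDiff ℝ 1 f) (a : Fin n → ℝ)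
    (B : Matrix (Fin n) (Fin m) ℝ) (z : Fin m → ℝ) (j : Fin m) :
    pgrad (fun z => f (a + B *ᵥ z)) z j = ∑ i, pgrad f (a + B *ᵥ z) i * B i j := by
  have h1 : HasFDerivAt (fun z : Fin m → ℝ => a + B *ᵥ z)
      (LinearMap.toContinuousLinearMap (Matrix.mulVecLin B)) z := by
    have := (LinearMap.toContinuousLinearMap (Matrix.mulVecLin B)).hasFDerivAt (x := z)
    exact this.const_add a
  have h2 : HasFDerivAt f (fderiv ℝ f (a + B *ᵥ z)) (a + B *ᵥ z) :=
    ((hf.differentiable one_ne_zero) _).hasFDerivAt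
  have h3 := h2.comp z h1
  have h4 : fderiv ℝ (fun z => f (a + B *ᵥ z)) z = _ := h3.fderiv
  unfold pgrad
  rw [h4]
  have h5 : B *ᵥ (Pi.single j 1) = ∑ i, B i j • (Pi.single i (1 : ℝ) : Fin n → ℝ) := by
    funext l
    simp [Finset.sum_apply, Pi.single_apply]
  simp only [ContinuousLinearMap.comp_apply, LinearMap.coe_toContinuousLinearMap', mulVecLin_apply]
  rw [h5, map_sum]
  simp [mul_comm]

lemma mulVec_cont {n m : ℕ} (B : Matrix (Fin n) (Fin m) ℝ) :
    Continuous (fun z : Fin m → ℝ => B *ᵥ z) :=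
  (LinearMap.toContinuousLinearMap (Matrix.mulVecLin B)).continuous

lemma var_bound (k m : ℕ) (f : (Fin (k + m) → ℝ) → ℝ) (hf : ContDiff ℝ 1 f)
    (hsq : ∀ i, Integrable (fun x => pgrad f x i ^ 2) (gaussM (k + m)))
    (U : Matrix (Fin (k + m)) (Fin (k + m)) ℝ) (hU : Uᵀ * U = 1) :
    ∫⁻ y, ∫⁻ z, ENNReal.ofReal ((f (U.submatrix id (Fin.castAdd m) *ᵥ y +
        U.submatrix id (Fin.natAdd k) *ᵥ z) -
      ∫ z, f (U.submatrix id (Fin.castAdd m) *ᵥ y +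
        U.submatrix id (Fin.natAdd k) *ᵥ z) ∂gaussM m) ^ 2) ∂gaussM m ∂gaussM k ≤
    ENNReal.ofReal (∑ j : Fin m, (Uᵀ * (Matrix.of fun i l => ∫ x, pgrad f x i * pgrad f x l
      ∂gaussM (k + m)) * U) (Fin.natAdd k j) (Fin.natAdd k j)) := by
  set U1 := U.submatrix id (Fin.castAdd m) with hU1
  set U2 := U.submatrix id (Fin.natAdd k) with hU2
  have hc1 := mulVec_cont U1
  have hc2 := mulVec_cont U2
  have hpc := fun i => pgrad_cont hf i
  have q : ∀ j : Fin m, Continuous (fun x => (∑ i, pgrad f x i * U2 i j) ^ 2) := fun j => by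
    fun_prop
  have step1 : ∀ y, ∫⁻ z, ENNReal.ofReal ((f (U1 *ᵥ y + U2 *ᵥ z) -
      ∫ z, f (U1 *ᵥ y + U2 *ᵥ z) ∂gaussM m) ^ 2) ∂gaussM m ≤
      ∑ j : Fin m, ∫⁻ z, ENNReal.ofReal ((∑ i, pgrad f (U1 *ᵥ y + U2 *ᵥ z) i * U2 i j) ^ 2)
        ∂gaussM m := by
    intro y
    have hcd : ContDiff ℝ 1 (fun z => f (U1 *ᵥ y + U2 *ᵥ z)) := by
      refine hf.comp (contDiff_const.add ?_)
      exact (LinearMap.toContinuousLinearMap (Matrix.mulVecLin U2)).contDiff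
    have h1 := var_le_pairs (gaussM m) (fun z => f (U1 *ᵥ y + U2 *ᵥ z))
      hcd.continuous.measurable
    have h2 := poincare_pi m _ hcd
    have h3 := h1.trans h2
    simp only [slice_pgrad f hf] at h3
    exact (ENNReal.mul_le_mul_iff_right (by norm_num) (by norm_num)).1 h3
  have step2 : ∫⁻ y, ∑ j : Fin m, ∫⁻ z, ENNReal.ofReal
      ((∑ i, pgrad f (U1 *ᵥ y + U2 *ᵥ z) i * U2 i j) ^ 2) ∂gaussM m ∂gaussM k =
      ∑ j : Fin m, ∫⁻ x, ENNReal.ofReal ((∑ i, pgrad f x i * U2 i j) ^ 2) ∂gaussM (k + m) := by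
    have hmeas : ∀ j : Fin m, Measurable (fun p : (Fin k → ℝ) × (Fin m → ℝ) => ENNReal.ofReal
      ((∑ i, pgrad f (U1 *ᵥ p.1 + U2 *ᵥ p.2) i * U2 i j) ^ 2)) := by
      intro j
      refine ENNReal.measurable_ofReal.comp (Continuous.measurable ?_)
      exact (q j).comp ((hc1.comp continuous_fst).add (hc2.comp continuous_snd))
    rw [lintegral_finsetSum _ (fun j _ => (hmeas j).lintegral_prod_right')]
    refine Finset.sum_congr rfl fun j _ => ?_
    have hT := T_pres k m U hU
    rw [← hT.lintegral_comp (f := fun x => ENNReal.ofReal ((∑ i, pgrad f x i * U2 i j) ^ 2))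
      (ENNReal.measurable_ofReal.comp (q j).measurable),
      lintegral_prod _ (hmeas j).aemeasurable]
  refine (lintegral_mono step1).trans ?_
  rw [step2]
  have hL2 : ∀ i, MemLp (fun x => pgrad f x i) 2 (gaussM (k + m)) := fun i =>
    (memLp_two_iff_integrable_sq (hpc i).aestronglyMeasurable).2 (hsq i)
  have hprod : ∀ i l, Integrable (fun x => pgrad f x i * pgrad f x l) (gaussM (k + m)) :=
    fun i l => (hL2 i).integrable_mul (hL2 l)
  have step3 : ∀ j : Fin m, ∫⁻ x, ENNReal.ofReal ((∑ i, pgrad f x i * U2 i j) ^ 2)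
      ∂gaussM (k + m) = ENNReal.ofReal (∫ x, (∑ i, pgrad f x i * U2 i j) ^ 2 ∂gaussM (k + m)) := by
    intro j
    have hm : MemLp (fun x => ∑ i, pgrad f x i * U2 i j) 2 (gaussM (k + m)) :=
      memLp_finsetSum _ (fun i _ => (hL2 i).mul_const _)
    rw [ofReal_integral_eq_lintegral_ofReal hm.integrable_sq
      (Filter.Eventually.of_forall fun x => sq_nonneg _)]
  simp only [step3]
  rw [← ENNReal.ofReal_sum_of_nonneg (fun j _ => integral_nonneg fun x => sq_nonneg _)]
  refine le_of_eq ?_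
  congr 1
  refine Finset.sum_congr rfl fun j _ => ?_
  have e : (fun x => (∑ i, pgrad f x i * U2 i j) ^ 2) = fun x =>
      ∑ l, ∑ i, (pgrad f x i * pgrad f x l) * (U2 i j * U2 l j) := by
    funext x
    rw [sq, Finset.sum_mul_sum, Finset.sum_comm]
    refine Finset.sum_congr rfl fun l _ => Finset.sum_congr rfl fun i _ => by ring
  rw [e, integral_finsetSum _ (fun l _ => integrable_finsetSum _ fun i _ =>
    (hprod i l).mul_const _), Matrix.mul_apply]
  refine Finset.sum_congr rfl fun l _ => ?_
  rw [integral_finsetSum _ (fun i _ => (hprod i l).mul_const _), Matrix.mul_apply, Finset.sum_mul]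
  refine Finset.sum_congr rfl fun i _ => ?_
  rw [integral_mul_const]
  simp [hU2]
  ring

lemma hell_gauss (n : ℕ) (u v : (Fin n → ℝ) → ℝ) (a b : ℝ) (ha : 0 ≤ a) (hb : 0 ≤ b) :
    hellingerDist (fun x => Real.exp (-u x) * gaussDensity n x / a)
      (fun x => Real.exp (-v x) * gaussDensity n x / b) =
    Real.sqrt ((1 / 2) * ∫ x, (Real.sqrt (Real.exp (-u x) / a) -
      Real.sqrt (Real.exp (-v x) / b)) ^ 2 ∂gaussM n) := by
  unfold hellingerDist
  rw [← integral_gauss]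
  congr 3
  funext x
  have hg := (gaussDensity_pos n x).le
  have e : ∀ t c : ℝ, 0 ≤ c → Real.sqrt (Real.exp t * gaussDensity n x / c) =
      Real.sqrt (Real.exp t / c) * Real.sqrt (gaussDensity n x) := by
    intro t c hc
    rw [← Real.sqrt_mul (by positivity)]
    congr 1; ring
  rw [e _ _ ha, e _ _ hb, ← sub_mul, mul_pow, Real.sq_sqrt hg]

/-- Expected Hellinger bound between the true posterior
`ρ_post = e^{-f}ρX/Z` and the random approximate posterior
`ρ_{post,ĝ_N}(·,ω) = e^{-f_{ĝ_N}(·,ω)}ρX/Z_{ĝ_N}(ω)`: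
`E[d_H(ρ_post, ρ_{post,ĝ_N})] ≤ L(1+N^{-1/2})(ε(λ₁+⋯+λ_k)^{1/2} + (λ_{k+1}+⋯+λ_{k+m})^{1/2})`
with `L² = (1/8)(Z exp(-∫ f ρX dx))^{-1/2}`, `Z = ∫ e^{-f} ρX dx`. -/
theorem expected_hellinger_true_posterior_bound
    (k m : ℕ)
    (f : (Fin (k + m) → ℝ) → ℝ)
    (hf : ContDiff ℝ 1 f)
    (hfnonneg : ∀ x, 0 ≤ f x)
    (hfint : Integrable fun x => f x * gaussDensity (k + m) x)
    (hsq : ∀ i, Integrable fun x => (pgrad f x i) ^ 2 * gaussDensity (k + m) x)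
    (W : Matrix (Fin (k + m)) (Fin (k + m)) ℝ)
    (hW : Wᵀ * W = 1)
    (Λ : Fin (k + m) → ℝ)
    (hΛdesc : ∀ i j, i ≤ j → Λ j ≤ Λ i)
    (hΛnonneg : ∀ i, 0 ≤ Λ i)
    (hC : (Matrix.of fun i j => ∫ x, pgrad f x i * pgrad f x j * gaussDensity (k + m) x) =
      W * Matrix.diagonal Λ * Wᵀ)
    (Wh : Matrix (Fin (k + m)) (Fin (k + m)) ℝ)
    (hWh : Whᵀ * Wh = 1)
    (ε : ℝ) (hε : 0 < ε)
    (hpert : ‖W - Wh‖ ≤ ε)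
    (gh : (Fin k → ℝ) → ℝ)
    (hgh : ∀ y, gh y = ∫ z, f (Wh.submatrix id (Fin.castAdd m) *ᵥ y +
      Wh.submatrix id (Fin.natAdd k) *ᵥ z) * gaussDensity m z)
    (Ω : Type*) [MeasurableSpace Ω] (P : Measure Ω) [IsProbabilityMeasure P]
    (N : ℕ) (hN : 1 ≤ N)
    (Z : Fin N → (Fin k → ℝ) → Ω → (Fin m → ℝ))
    (hZmeas : ∀ j, Measurable fun p : (Fin k → ℝ) × Ω => Z j p.1 p.2)
    (hZlaw : ∀ j y, Measure.map (Z j y) P =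
      volume.withDensity fun z => ENNReal.ofReal (gaussDensity m z))
    (hZindep : ∀ y, iIndepFun (fun j => Z j y) P)
    (ghN : (Fin k → ℝ) → Ω → ℝ)
    (hghN : ∀ y ω, ghN y ω = (N : ℝ)⁻¹ * ∑ j, f (Wh.submatrix id (Fin.castAdd m) *ᵥ y +
      Wh.submatrix id (Fin.natAdd k) *ᵥ Z j y ω))
    (Znorm Zgh : ℝ) (ZghN : Ω → ℝ)
    (hZnorm : Znorm = ∫ x, Real.exp (-f x) * gaussDensity (k + m) x)
    (hZgh : Zgh = ∫ x, Real.exp (-gh ((Wh.submatrix id (Fin.castAdd m))ᵀ *ᵥ x)) *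
      gaussDensity (k + m) x)
    (hZghN : ∀ ω, ZghN ω = ∫ x,
      Real.exp (-ghN ((Wh.submatrix id (Fin.castAdd m))ᵀ *ᵥ x) ω) * gaussDensity (k + m) x)
    (L : ℝ) (hLpos : 0 < L)
    (hL : L ^ 2 = (1 / 8) *
      (Znorm * Real.exp (-∫ x, f x * gaussDensity (k + m) x)) ^ (-(1 / 2 : ℝ))) :
    ∫ ω, hellingerDist
        (fun x => Real.exp (-f x) * gaussDensity (k + m) x / Znorm)
        (fun x => Real.exp (-ghN ((Wh.submatrix id (Fin.castAdd m))ᵀ *ᵥ x) ω) *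
          gaussDensity (k + m) x / ZghN ω) ∂P ≤
      L * (1 + (N : ℝ) ^ (-(1 / 2 : ℝ))) *
        (ε * Real.sqrt (∑ j : Fin k, Λ (Fin.castAdd m j)) +
          Real.sqrt (∑ j : Fin m, Λ (Fin.natAdd k j))) := by
  have hfm : Measurable f := hf.continuous.measurable
  set U1 := Wh.submatrix id (Fin.castAdd m) with hU1
  set U2 := Wh.submatrix id (Fin.natAdd k) with hU2
  have hc1 := mulVec_cont U1
  have hc2 := mulVec_cont U2
  have hc3 := mulVec_cont U1ᵀ
  simp only [integral_gauss (k + m)] at hC hZnorm hZghN hL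
  simp only [integral_gauss m (fun z => f (_ + U2 *ᵥ z))] at hgh
  rw [integrable_gauss] at hfint
  simp only [integrable_gauss (k + m)] at hsq
  simp only [withDensity_gauss] at hZlaw
  have hT := T_pres k m Wh hWh
  have hTinv : ∀ y z, U1ᵀ *ᵥ (U1 *ᵥ y + U2 *ᵥ z) = y := T_inv k m Wh hWh
  have hTc : Continuous (fun p : (Fin k → ℝ) × (Fin m → ℝ) => U1 *ᵥ p.1 + U2 *ᵥ p.2) :=
    (hc1.comp continuous_fst).add (hc2.comp continuous_snd)
  set s := ε * Real.sqrt (∑ j : Fin k, Λ (Fin.castAdd m j)) +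
    Real.sqrt (∑ j : Fin m, Λ (Fin.natAdd k j)) with hs
  have hs0 : 0 ≤ s := by positivity
  have hfT : Measurable (fun p : (Fin k → ℝ) × (Fin m → ℝ) => f (U1 *ᵥ p.1 + U2 *ᵥ p.2)) :=
    hfm.comp hTc.measurable
  have hghm : Measurable gh := by
    have : gh = fun y => ∫ z, f (U1 *ᵥ y + U2 *ᵥ z) ∂gaussM m := funext hgh
    rw [this]
    exact (hfT.stronglyMeasurable.integral_prod_right (ν := gaussM m)).measurable
  -- variance bound
  have hv := var_bound k m f hf hsq Wh hWh
  rw [hC] at hv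
  simp only [← hU1, ← hU2, ← hgh] at hv
  replace hv := hv.trans (ENNReal.ofReal_le_ofReal
    (lin_alg k m W Wh _ hW hWh Λ hΛnonneg rfl ε hε hpert))
  rw [← hs] at hv
  have hVm : Measurable (fun y => ∫⁻ z, ENNReal.ofReal ((f (U1 *ᵥ y + U2 *ᵥ z) - gh y) ^ 2)
      ∂gaussM m) :=
    Measurable.lintegral_prod_right' (f := fun p : (Fin k → ℝ) × (Fin m → ℝ) =>
      ENNReal.ofReal ((f (U1 *ᵥ p.1 + U2 *ᵥ p.2) - gh p.1) ^ 2))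
      (by fun_prop)
  have hVfin := ae_lt_top hVm (hv.trans_lt ENNReal.ofReal_lt_top).ne
  -- the projection is measure preserving
  have hpr : MeasurePreserving (fun x => U1ᵀ *ᵥ x) (gaussM (k + m)) (gaussM k) := by
    refine ⟨hc3.measurable, ?_⟩
    rw [← hT.map_eq, Measure.map_map hc3.measurable hT.measurable]
    have : (fun x => U1ᵀ *ᵥ x) ∘ (fun p : (Fin k → ℝ) × (Fin m → ℝ) =>
        U1 *ᵥ p.1 + U2 *ᵥ p.2) = Prod.fst := by
      funext p; exact hTinv p.1 p.2
    rw [this]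
    exact measurePreserving_fst.map_eq
  have hNr : (0 : ℝ) < N := by exact_mod_cast hN
  have hN1 : (1 : ℝ) ≤ N := by exact_mod_cast hN
  have hh2 : ((N : ℝ) ^ (-(1 / 2 : ℝ))) ^ 2 = (N : ℝ)⁻¹ := by
    rw [← Real.rpow_natCast, ← Real.rpow_mul hNr.le, ← Real.rpow_neg_one]
    norm_num
  have hmcy : ∀ y, ∫⁻ z, ENNReal.ofReal ((f (U1 *ᵥ y + U2 *ᵥ z) - gh y) ^ 2) ∂gaussM m < ⊤ →
      Integrable (ghN y) P ∧ ∫ ω, ghN y ω ∂P = gh y ∧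
      ∫⁻ ω, ENNReal.ofReal ((ghN y ω - gh y) ^ 2) ∂P = ENNReal.ofReal ((N : ℝ)⁻¹) *
        ∫⁻ z, ENNReal.ofReal ((f (U1 *ᵥ y + U2 *ᵥ z) - gh y) ^ 2) ∂gaussM m := by
    intro y hy
    have h1 := mc_lemma P (gaussM m) N hN (fun j => Z j y)
      (fun j => (hZmeas j).comp measurable_prodMk_left) (fun j => hZlaw j y) (hZindep y)
      (fun z => f (U1 *ᵥ y + U2 *ᵥ z)) (hfT.comp measurable_prodMk_left)
      (by simp only [← hgh]; exact hy.ne)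
    simp only [← hgh, ← hghN] at h1
    exact h1
  have hghNm : Measurable (fun p : (Fin k → ℝ) × Ω => ghN p.1 p.2) := by
    simp only [hghN]
    refine Measurable.const_mul (Finset.measurable_sum _ fun j _ => ?_) _
    exact hfT.comp (measurable_fst.prodMk (hZmeas j))
  have hfTi : Integrable (fun p : (Fin k → ℝ) × (Fin m → ℝ) => f (U1 *ᵥ p.1 + U2 *ᵥ p.2))
      ((gaussM k).prod (gaussM m)) := hT.integrable_comp_of_integrable hfint
  have hZ0 : 0 ≤ Znorm := by
    rw [hZnorm]; exact integral_nonneg fun x => (Real.exp_pos _).le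
  have hZN0 : ∀ ω, 0 ≤ ZghN ω := fun ω => by
    rw [hZghN]; exact integral_nonneg fun x => (Real.exp_pos _).le
  have key := core (gaussM (k + m)) P f (fun x => gh (U1ᵀ *ᵥ x)) (fun x ω => ghN (U1ᵀ *ᵥ x) ω)
    hfm (hghm.comp hc3.measurable)
    (hghNm.comp ((hc3.measurable.comp measurable_fst).prodMk measurable_snd)) hfnonneg
    (fun x ω => by
      rw [hghN]
      exact mul_nonneg (by positivity) (Finset.sum_nonneg fun j _ => hfnonneg _))
    hfint (s ^ 2) ((N : ℝ) ^ (-(1 / 2 : ℝ))) (sq_nonneg s) (by positivity)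
    (Real.rpow_le_one_of_one_le_of_nonpos hN1 (by norm_num))
    (by
      refine le_trans (le_of_eq ?_) hv
      rw [← hT.lintegral_comp
        (f := fun x => ENNReal.ofReal ((f x - gh (U1ᵀ *ᵥ x)) ^ 2)) (by fun_prop)]
      rw [lintegral_prod _ (by fun_prop)]
      simp only [← hU1, ← hU2, hTinv])
    (by
      filter_upwards [hpr.quasiMeasurePreserving.ae hVfin] with x hx
      have := hmcy _ hx
      exact ⟨this.1, this.2.1⟩)
    (by
      have e : ∀ᵐ x ∂gaussM (k + m),
          ∫⁻ ω, ENNReal.ofReal ((ghN (U1ᵀ *ᵥ x) ω - gh (U1ᵀ *ᵥ x)) ^ 2) ∂P =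
          ENNReal.ofReal ((N : ℝ)⁻¹) * ∫⁻ z, ENNReal.ofReal ((f (U1 *ᵥ (U1ᵀ *ᵥ x) + U2 *ᵥ z) -
            gh (U1ᵀ *ᵥ x)) ^ 2) ∂gaussM m := by
        filter_upwards [hpr.quasiMeasurePreserving.ae hVfin] with x hx
        exact (hmcy _ hx).2.2
      have hVm2 : Measurable (fun x => ∫⁻ z, ENNReal.ofReal ((f (U1 *ᵥ (U1ᵀ *ᵥ x) + U2 *ᵥ z) -
            gh (U1ᵀ *ᵥ x)) ^ 2) ∂gaussM m) := hVm.comp hc3.measurable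
      rw [lintegral_congr_ae e, lintegral_const_mul _ hVm2,
        hpr.lintegral_comp hVm, hh2, mul_comm, ENNReal.ofReal_mul (sq_nonneg s)]
      exact mul_le_mul_left hv _)
    (by
      have e1 : ∫ x, gh (U1ᵀ *ᵥ x) ∂gaussM (k + m) = ∫ y, gh y ∂gaussM k := by
        rw [← hpr.map_eq, integral_map hc3.aemeasurable hghm.aestronglyMeasurable]
      have e2 : ∫ x, f x ∂gaussM (k + m) = ∫ p, f (U1 *ᵥ p.1 + U2 *ᵥ p.2)
          ∂((gaussM k).prod (gaussM m)) := by
        rw [← hT.map_eq, integral_map hT.measurable.aemeasurable hfm.aestronglyMeasurable]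
      rw [e1, e2, integral_prod _ hfTi]
      simp only [hgh])
    L hLpos (by rw [hL, hZnorm])
    (fun ω => hellingerDist (fun x => Real.exp (-f x) * gaussDensity (k + m) x / Znorm)
      (fun x => Real.exp (-ghN (U1ᵀ *ᵥ x) ω) * gaussDensity (k + m) x / ZghN ω))
    (fun ω => by
      rw [hell_gauss (k + m) f (fun x => ghN (U1ᵀ *ᵥ x) ω) Znorm (ZghN ω) hZ0 (hZN0 ω),
        hZnorm, hZghN])
  rw [Real.sqrt_sq hs0] at key
  exact key
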